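/- arXiv:2107.09838 — 3 statements merged into one kernel-verified Lean document; each statement's English description precedes it below -/
import Mathlib

section
/- Let f, g, h be nonnegative, monotone decreasing, Lebesgue-measurable functions on the unit square [0,1]^2. Then E_3(f,g,h) ≥ 0, where E_3(f,g,h) = 2E(fgh) + E(f)E(g)E(h) − E(f)E(gh) − E(g)E(fh) − E(h)E(fg) and E denotes the integral with respect to Lebesgue measure on [0,1]^2. -/
open MeasureTheory

/-- The unit square `[0,1]^2` in `Fin 2 → ℝ`, with the componentwise order. -/
def unitSquare : Set (Fin 2 → ℝ) := Set.Icc 0 1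

/-- Expectation: integral over the unit square with respect to Lebesgue measure
(which is a probability measure on the unit square). -/
noncomputable def sqE (f : (Fin 2 → ℝ) → ℝ) : ℝ := ∫ x in unitSquare, f x

open Equiv

/-- A trilinear form in three sample points; its expectation over independent samples is `E₃`. -/
def tripleForm {X R : Type*} [CommRing R] (f g h : X → R) (p : Fin 3 → X) : R :=
  2 * (f (p 0) * g (p 0) * h (p 0)) + f (p 0) * g (p 1) * h (p 2)
    - f (p 0) * (g (p 1) * h (p 1)) - g (p 0) * (f (p 1) * h (p 1)) - h (p 0) * (f (p 1) * g (p 1))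

/-- The symmetrization of `tripleForm` over all ways of pairing three rows with three columns. -/
def gridForm {R : Type*} [CommRing R] (f g h : Fin 3 × Fin 3 → R) : R :=
  ∑ σ : Perm (Fin 3), ∑ τ : Perm (Fin 3), tripleForm f g h (fun i => (σ i, τ i))

theorem sum_perm_three {M : Type*} [AddCommMonoid M] (φ : Perm (Fin 3) → M) :
    ∑ σ, φ σ = φ 1 + (φ (swap 0 1) + (φ (swap 0 2) + (φ (swap 1 2) +
      (φ (swap 0 1 * swap 1 2) + φ (swap 1 2 * swap 0 1))))) := by
  have h : (Finset.univ : Finset (Perm (Fin 3))) =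
      {1, swap 0 1, swap 0 2, swap 1 2, swap 0 1 * swap 1 2, swap 1 2 * swap 0 1} := by decide
  rw [h]
  repeat rw [Finset.sum_insert (by decide)]
  rw [Finset.sum_singleton]

/-- The coefficient of `f p` in the positive part of `gridForm f g h`. -/
def posWeight {R : Type*} [CommSemiring R] (g h : Fin 3 × Fin 3 → R) (p : Fin 3 × Fin 3) : R :=
  8 * (g p * h p) + (g (p + (1, 1)) * h (p + (2, 2)) + g (p + (1, 2)) * h (p + (2, 1))
    + g (p + (2, 1)) * h (p + (1, 2)) + g (p + (2, 2)) * h (p + (1, 1)))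

/-- The coefficient of `f p` in the negative part of `gridForm f g h`. -/
def negWeight {R : Type*} [CommSemiring R] (g h : Fin 3 × Fin 3 → R) (p : Fin 3 × Fin 3) : R :=
  g (p + (1, 1)) * h (p + (1, 1)) + g (p + (1, 2)) * h (p + (1, 2))
    + g (p + (2, 1)) * h (p + (2, 1)) + g (p + (2, 2)) * h (p + (2, 2))
    + g p * (h (p + (1, 1)) + h (p + (1, 2)) + h (p + (2, 1)) + h (p + (2, 2)))
    + h p * (g (p + (1, 1)) + g (p + (1, 2)) + g (p + (2, 1)) + g (p + (2, 2)))

theorem gridForm_eq_sum_weight {R : Type*} [CommRing R] (f g h : Fin 3 × Fin 3 → R) :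
    gridForm f g h = ∑ p, f p * posWeight g h p - ∑ p, f p * negWeight g h p := by
  simp only [gridForm, sum_perm_three, tripleForm, posWeight, negWeight, Fintype.sum_prod_type,
    Fin.sum_univ_three, swap_apply_def, Perm.mul_apply, Perm.one_apply, Prod.mk_add_mk]
  simp only [Fin.isValue, reduceIte, Fin.reduceEq, Fin.reduceAdd]
  ring

/-- The row lengths of the twenty lower sets of the `3 × 3` grid. -/
def staircaseHeights : List (ℕ × ℕ × ℕ) :=
  [(0, 0, 0), (1, 0, 0), (2, 0, 0), (3, 0, 0), (1, 1, 0), (2, 1, 0), (3, 1, 0), (2, 2, 0),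
    (3, 2, 0), (3, 3, 0), (1, 1, 1), (2, 1, 1), (3, 1, 1), (2, 2, 1), (3, 2, 1), (3, 3, 1),
    (2, 2, 2), (3, 2, 2), (3, 3, 2), (3, 3, 3)]

/-- The indicator of the lower set of the `3 × 3` grid with row lengths `a`. -/
def staircase (a : ℕ × ℕ × ℕ) (p : Fin 3 × Fin 3) : ℕ :=
  (Nat.blt p.2 (![a.1, a.2.1, a.2.2] p.1)).toNat

theorem exists_staircase_eq : ∀ χ : Fin 3 → Fin 3 → Bool,
    (∀ i j k l, i ≤ k → j ≤ l → χ k l = true → χ i j = true) →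
    ∃ a ∈ staircaseHeights, ∀ i j, (χ i j).toNat = staircase a (i, j) := by
  decide +kernel

theorem sum_negWeight_le : ∀ b ∈ staircaseHeights, ∀ c ∈ staircaseHeights, ∀ a ∈ staircaseHeights,
    ∑ p, staircase a p * negWeight (staircase b) (staircase c) p ≤
      ∑ p, staircase a p * posWeight (staircase b) (staircase c) p := by
  simp only [Fintype.sum_prod_type, Fin.sum_univ_three]
  decide +kernel

/-- A linear functional that is nonnegative on indicators of lower sets is nonnegative on every
nonnegative antitone function. -/
theorem LinearMap.nonneg_of_antitone {P : Type*} [Fintype P] [Preorder P] (L : (P → ℝ) →ₗ[ℝ] ℝ)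
    (hL : ∀ s : Set P, IsLowerSet s → 0 ≤ L (s.indicator 1)) (f : P → ℝ) (hf : Antitone f)
    (hf₀ : 0 ≤ f) : 0 ≤ L f := by
  classical
  induction hn : (Finset.univ.filter (fun p => f p ≠ 0)).card using Nat.strong_induction_on
    generalizing f with
  | _ n ih =>
    subst hn
    rcases (Finset.univ.filter (fun p => f p ≠ 0)).eq_empty_or_nonempty with he | hne
    · have : f = 0 := by
        ext p
        by_contra hp
        have : p ∈ Finset.univ.filter (fun p => f p ≠ 0) := by simpa using hp
        simp [he] at this
      simp [this]
    · obtain ⟨q, hq, hmin⟩ := Finset.exists_min_image _ f hne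
      have hq₀ : f q ≠ 0 := by simpa using hq
      have hmin' : ∀ p, f p ≠ 0 → f q ≤ f p := fun p hp => hmin p (by simpa using hp)
      have hpos : ∀ p, f p ≠ 0 → 0 < f p := fun p hp => lt_of_le_of_ne (hf₀ p) (Ne.symm hp)
      have hs : IsLowerSet (Function.support f) := fun a b hba ha =>
        ((hpos a ha).trans_le (hf hba)).ne'
      have key := ih _ ?_ (f - f q • (Function.support f).indicator 1) ?_ ?_ rfl
      · have h₁ := mul_nonneg (hf₀ q) (hL _ hs)
        rw [map_sub, map_smul, smul_eq_mul] at key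
        linarith
      · refine Finset.card_lt_card (Finset.ssubset_iff_of_subset ?_ |>.2 ⟨q, hq, ?_⟩)
        · intro p
          simp only [Finset.mem_filter, Finset.mem_univ, true_and]
          intro hp h0
          simp [h0] at hp
        · simp [hq₀]
      · intro a b hab
        by_cases hb : f b = 0
        · by_cases ha : f a = 0
          · simp [ha, hb]
          · simpa [ha, hb] using hmin' a ha
        · have ha : f a ≠ 0 := hs hab hb
          simpa [ha, hb] using hf hab
      · intro p
        by_cases hp : f p = 0
        · simp [hp]
        · simpa [hp] using hmin' p hp

theorem exists_indicator_eq_staircase {s : Set (Fin 3 × Fin 3)} (hs : IsLowerSet s) :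
    ∃ a ∈ staircaseHeights, s.indicator (1 : Fin 3 × Fin 3 → ℝ) = fun p => (staircase a p : ℝ) := by
  classical
  obtain ⟨a, ha, h⟩ := exists_staircase_eq (fun i j => decide ((i, j) ∈ s))
    (fun i j k l hik hjl hkl => by
      simp only [decide_eq_true_eq] at hkl ⊢
      exact hs (Prod.mk_le_mk.2 ⟨hik, hjl⟩) hkl)
  refine ⟨a, ha, funext fun p => ?_⟩
  rw [← h p.1 p.2]
  by_cases hp : p ∈ s <;> simp [hp]

theorem gridForm_staircase_nonneg {a b c : ℕ × ℕ × ℕ} (ha : a ∈ staircaseHeights)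
    (hb : b ∈ staircaseHeights) (hc : c ∈ staircaseHeights) :
    0 ≤ gridForm (fun p => (staircase a p : ℝ)) (fun p => (staircase b p : ℝ))
      (fun p => (staircase c p : ℝ)) := by
  have h := (Nat.cast_le (α := ℝ)).2 (sum_negWeight_le b hb c hc a ha)
  rw [gridForm_eq_sum_weight, sub_nonneg]
  simpa only [negWeight, posWeight, Nat.cast_sum, Nat.cast_mul, Nat.cast_add,
    Nat.cast_ofNat] using h

theorem gridForm_swap_left {R : Type*} [CommRing R] (f g h : Fin 3 × Fin 3 → R) :
    gridForm f g h = gridForm g f h := by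
  simp only [gridForm_eq_sum_weight, posWeight, negWeight, Fintype.sum_prod_type,
    Fin.sum_univ_three, Prod.mk_add_mk, Fin.isValue, Fin.reduceAdd]
  ring

theorem gridForm_swap_right {R : Type*} [CommRing R] (f g h : Fin 3 × Fin 3 → R) :
    gridForm f g h = gridForm f h g := by
  simp only [gridForm_eq_sum_weight, posWeight, negWeight]
  congr 1 <;> exact Finset.sum_congr rfl fun p _ => by ring

/-- `gridForm` as a linear functional of its first argument. -/
def gridFormLinear (g h : Fin 3 × Fin 3 → ℝ) : (Fin 3 × Fin 3 → ℝ) →ₗ[ℝ] ℝ where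
  toFun f := gridForm f g h
  map_add' f₁ f₂ := by
    simp only [gridForm_eq_sum_weight, Pi.add_apply, add_mul, Finset.sum_add_distrib]
    ring
  map_smul' r f := by
    simp only [gridForm_eq_sum_weight, Pi.smul_apply, smul_eq_mul, mul_assoc, ← Finset.mul_sum,
      RingHom.id_apply, mul_sub]

theorem gridForm_nonneg {f g h : Fin 3 × Fin 3 → ℝ} (hf : Antitone f) (hg : Antitone g)
    (hh : Antitone h) (hf₀ : 0 ≤ f) (hg₀ : 0 ≤ g) (hh₀ : 0 ≤ h) : 0 ≤ gridForm f g h := by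
  refine (gridFormLinear g h).nonneg_of_antitone (fun s hs => ?_) f hf hf₀
  change 0 ≤ gridForm _ _ _
  rw [gridForm_swap_left]
  refine (gridFormLinear _ h).nonneg_of_antitone (fun t ht => ?_) g hg hg₀
  change 0 ≤ gridForm _ _ _
  rw [gridForm_swap_right, gridForm_swap_left]
  refine (gridFormLinear _ _).nonneg_of_antitone (fun r hr => ?_) h hh hh₀
  obtain ⟨a, ha, hsa⟩ := exists_indicator_eq_staircase hs
  obtain ⟨b, hb, htb⟩ := exists_indicator_eq_staircase ht
  obtain ⟨c, hc, hrc⟩ := exists_indicator_eq_staircase hr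
  rw [hsa, htb, hrc]
  exact gridForm_staircase_nonneg hc hb ha

theorem gridForm_comp_perm {R : Type*} [CommRing R] (ρ π : Perm (Fin 3))
    (f g h : Fin 3 × Fin 3 → R) :
    gridForm (f ∘ Prod.map ρ π) (g ∘ Prod.map ρ π) (h ∘ Prod.map ρ π) = gridForm f g h :=
  Fintype.sum_equiv (Equiv.mulLeft ρ) _ _ fun _ =>
    Fintype.sum_equiv (Equiv.mulLeft π) _ _ fun _ => rfl

theorem gridForm_sample_nonneg {α β : Type*} [LinearOrder α] [LinearOrder β] {f g h : α × β → ℝ}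
    (hf : Antitone f) (hg : Antitone g) (hh : Antitone h) (hf₀ : 0 ≤ f) (hg₀ : 0 ≤ g)
    (hh₀ : 0 ≤ h) (u : Fin 3 → α) (v : Fin 3 → β) :
    0 ≤ gridForm (f ∘ Prod.map u v) (g ∘ Prod.map u v) (h ∘ Prod.map u v) := by
  rw [← gridForm_comp_perm (Tuple.sort u) (Tuple.sort v)]
  have hm : Monotone (Prod.map u v ∘ Prod.map (Tuple.sort u) (Tuple.sort v)) := by
    rw [Prod.map_comp_map]
    exact (Tuple.monotone_sort u).prodMap (Tuple.monotone_sort v)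
  exact gridForm_nonneg (hf.comp_monotone hm) (hg.comp_monotone hm) (hh.comp_monotone hm)
    (fun _ => hf₀ _) (fun _ => hg₀ _) (fun _ => hh₀ _)

section Sampling

variable {X α β : Type*} [MeasurableSpace X] [MeasurableSpace α] [MeasurableSpace β]

theorem integrable_mul_three {μ : Measure X} [SigmaFinite μ] {φ₀ φ₁ φ₂ : X → ℝ}
    (h₀ : Integrable φ₀ μ) (h₁ : Integrable φ₁ μ) (h₂ : Integrable φ₂ μ) :
    Integrable (fun p : Fin 3 → X => φ₀ (p 0) * φ₁ (p 1) * φ₂ (p 2)) (Measure.pi fun _ => μ) := by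
  have := Integrable.fintype_prod (f := ![φ₀, φ₁, φ₂]) (μ := fun _ : Fin 3 => μ)
    (by intro i; fin_cases i <;> assumption)
  simpa [Fin.prod_univ_three] using this

theorem integral_mul_three (μ : Measure X) [SigmaFinite μ] (φ₀ φ₁ φ₂ : X → ℝ) :
    ∫ p : Fin 3 → X, φ₀ (p 0) * φ₁ (p 1) * φ₂ (p 2) ∂(Measure.pi fun _ => μ) =
      (∫ x, φ₀ x ∂μ) * (∫ x, φ₁ x ∂μ) * ∫ x, φ₂ x ∂μ := by
  have := integral_fintype_prod_eq_prod (𝕜 := ℝ) ![φ₀, φ₁, φ₂] (μ := fun _ : Fin 3 => μ)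
  simpa [Fin.prod_univ_three] using this

/-- The third correlation functional `E₃`. -/
noncomputable def corrThree (μ : Measure X) (f g h : X → ℝ) : ℝ :=
  2 * (∫ x, f x * g x * h x ∂μ) + (∫ x, f x ∂μ) * (∫ x, g x ∂μ) * (∫ x, h x ∂μ)
    - (∫ x, f x ∂μ) * (∫ x, g x * h x ∂μ) - (∫ x, g x ∂μ) * (∫ x, f x * h x ∂μ)
    - (∫ x, h x ∂μ) * (∫ x, f x * g x ∂μ)

theorem tripleForm_integrable_and_integral_eq {μ : Measure X} [IsProbabilityMeasure μ]
    {f g h : X → ℝ} (hf : Integrable f μ) (hg : Integrable g μ) (hh : Integrable h μ)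
    (hgh : Integrable (fun x => g x * h x) μ) (hfh : Integrable (fun x => f x * h x) μ)
    (hfg : Integrable (fun x => f x * g x) μ) (hfgh : Integrable (fun x => f x * g x * h x) μ) :
    Integrable (tripleForm f g h) (Measure.pi fun _ : Fin 3 => μ) ∧
      ∫ p, tripleForm f g h p ∂(Measure.pi fun _ : Fin 3 => μ) = corrThree μ f g h := by
  have one : Integrable (fun _ : X => (1 : ℝ)) μ := integrable_const 1
  have i₁ := (integrable_mul_three hfgh one one).const_mul 2
  have i₂ := integrable_mul_three hf hg hh
  have i₃ := integrable_mul_three hf hgh one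
  have i₄ := integrable_mul_three hg hfh one
  have i₅ := integrable_mul_three hh hfg one
  have e : tripleForm f g h =
      (fun p : Fin 3 → X => 2 * (f (p 0) * g (p 0) * h (p 0) * 1 * 1))
        + (fun p => f (p 0) * g (p 1) * h (p 2)) - (fun p => f (p 0) * (g (p 1) * h (p 1)) * 1)
        - (fun p => g (p 0) * (f (p 1) * h (p 1)) * 1)
        - (fun p => h (p 0) * (f (p 1) * g (p 1)) * 1) := by
    funext p
    simp only [tripleForm, mul_one, Pi.add_apply, Pi.sub_apply]
  rw [e]
  refine ⟨(((i₁.add i₂).sub i₃).sub i₄).sub i₅, ?_⟩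
  rw [integral_sub' (((i₁.add i₂).sub i₃).sub i₄) i₅, integral_sub' ((i₁.add i₂).sub i₃) i₄,
    integral_sub' (i₁.add i₂) i₃, integral_add' i₁ i₂, integral_const_mul,
    integral_mul_three μ (fun x => f x * g x * h x) (fun _ => 1) (fun _ => 1),
    integral_mul_three μ f g h,
    integral_mul_three μ f (fun x => g x * h x) (fun _ => 1),
    integral_mul_three μ g (fun x => f x * h x) (fun _ => 1),
    integral_mul_three μ h (fun x => f x * g x) (fun _ => 1)]
  simp [corrThree]

theorem measurePreserving_comp_perm (μ : Measure X) [SigmaFinite μ] (σ : Perm (Fin 3)) :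
    MeasurePreserving (fun u : Fin 3 → X => u ∘ σ) (Measure.pi fun _ => μ)
      (Measure.pi fun _ => μ) :=
  measurePreserving_arrowCongr' (fun _ : Fin 3 => μ) (fun _ => μ) σ.symm (MeasurableEquiv.refl X)
    fun _ => MeasurePreserving.id μ

theorem measurePreserving_sample (μ : Measure α) (ν : Measure β) [SigmaFinite μ] [SigmaFinite ν]
    (σ τ : Perm (Fin 3)) :
    MeasurePreserving (fun (w : (Fin 3 → α) × (Fin 3 → β)) i => (w.1 (σ i), w.2 (τ i)))
      ((Measure.pi fun _ => μ).prod (Measure.pi fun _ => ν)) (Measure.pi fun _ => μ.prod ν) :=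
  ((measurePreserving_arrowProdEquivProdArrow α β (Fin 3) (fun _ => μ) (fun _ => ν)).symm _).comp
    ((measurePreserving_comp_perm μ σ).prod (measurePreserving_comp_perm ν τ))

/-- `E₃ ≥ 0` for bounded nonnegative antitone functions on a product of two linearly ordered
probability spaces. -/
theorem corrThree_prod_nonneg [LinearOrder α] [LinearOrder β] (μ : Measure α) (ν : Measure β)
    [IsProbabilityMeasure μ] [IsProbabilityMeasure ν] {f g h : α × β → ℝ}
    (hf : Antitone f) (hg : Antitone g) (hh : Antitone h) (hf₀ : 0 ≤ f) (hg₀ : 0 ≤ g)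
    (hh₀ : 0 ≤ h) (hfm : Measurable f) (hgm : Measurable g) (hhm : Measurable h) {C : ℝ}
    (hfC : ∀ x, f x ≤ C) (hgC : ∀ x, g x ≤ C) (hhC : ∀ x, h x ≤ C) :
    0 ≤ corrThree (μ.prod ν) f g h := by
  have bdd : ∀ {φ : α × β → ℝ}, 0 ≤ φ → (∀ x, φ x ≤ C) → ∀ᵐ x ∂(μ.prod ν), ‖φ x‖ ≤ C :=
    fun h₀ hC => ae_of_all _ fun x => by rw [Real.norm_of_nonneg (h₀ x)]; exact hC x
  have hfi := Integrable.of_bound hfm.aestronglyMeasurable C (bdd hf₀ hfC)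
  have hgi := Integrable.of_bound hgm.aestronglyMeasurable C (bdd hg₀ hgC)
  have hhi := Integrable.of_bound hhm.aestronglyMeasurable C (bdd hh₀ hhC)
  have hgh := hgi.mul_bdd hhm.aestronglyMeasurable (bdd hh₀ hhC)
  have hfh := hfi.mul_bdd hhm.aestronglyMeasurable (bdd hh₀ hhC)
  have hfg := hfi.mul_bdd hgm.aestronglyMeasurable (bdd hg₀ hgC)
  have hfgh := hfg.mul_bdd hhm.aestronglyMeasurable (bdd hh₀ hhC)
  obtain ⟨hi, he⟩ := tripleForm_integrable_and_integral_eq hfi hgi hhi hgh hfh hfg hfgh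
  have hint : ∀ σ τ : Perm (Fin 3), Integrable (fun w : (Fin 3 → α) × (Fin 3 → β) =>
      tripleForm f g h fun i => (w.1 (σ i), w.2 (τ i)))
      ((Measure.pi fun _ => μ).prod (Measure.pi fun _ => ν)) := fun σ τ =>
    (measurePreserving_sample μ ν σ τ).integrable_comp_of_integrable hi
  have hval : ∀ σ τ : Perm (Fin 3), ∫ w : (Fin 3 → α) × (Fin 3 → β),
      tripleForm f g h (fun i => (w.1 (σ i), w.2 (τ i)))
      ∂((Measure.pi fun _ => μ).prod (Measure.pi fun _ => ν)) = corrThree (μ.prod ν) f g h := by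
    intro σ τ
    have hmp := measurePreserving_sample μ ν σ τ
    rw [← he, ← hmp.map_eq, integral_map hmp.measurable.aemeasurable]
    rw [hmp.map_eq]
    exact hi.aestronglyMeasurable
  have hsum : ∫ w : (Fin 3 → α) × (Fin 3 → β),
      gridForm (f ∘ Prod.map w.1 w.2) (g ∘ Prod.map w.1 w.2) (h ∘ Prod.map w.1 w.2)
      ∂((Measure.pi fun _ => μ).prod (Measure.pi fun _ => ν)) =
      ∑ _σ : Perm (Fin 3), ∑ _τ : Perm (Fin 3), corrThree (μ.prod ν) f g h := by
    simp only [gridForm]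
    refine (integral_finsetSum _ fun σ _ => integrable_finsetSum _ fun τ _ => hint σ τ).trans
      (Finset.sum_congr rfl fun σ _ => ?_)
    exact (integral_finsetSum _ fun τ _ => hint σ τ).trans
      (Finset.sum_congr rfl fun τ _ => hval σ τ)
  have hnn : 0 ≤ ∑ _σ : Perm (Fin 3), ∑ _τ : Perm (Fin 3), corrThree (μ.prod ν) f g h :=
    hsum ▸ integral_nonneg fun w => gridForm_sample_nonneg hf hg hh hf₀ hg₀ hh₀ w.1 w.2
  simp only [Finset.sum_const, nsmul_eq_mul] at hnn
  have hcard : 0 < ((Finset.univ : Finset (Perm (Fin 3))).card : ℝ) := by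
    exact_mod_cast Finset.univ_nonempty.card_pos
  exact nonneg_of_mul_nonneg_right (nonneg_of_mul_nonneg_right hnn hcard) hcard

end Sampling

/-- The point of the unit square nearest to `p`. -/
noncomputable def squareClamp (p : ℝ × ℝ) : Fin 2 → ℝ :=
  ![max 0 (min 1 p.1), max 0 (min 1 p.2)]

theorem squareClamp_mem (p : ℝ × ℝ) : squareClamp p ∈ unitSquare := by
  refine ⟨fun i => ?_, fun i => ?_⟩ <;> fin_cases i <;> simp [squareClamp]

theorem squareClamp_monotone : Monotone squareClamp := by
  intro p q hpq i
  fin_cases i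
  · exact max_le_max le_rfl (min_le_min le_rfl hpq.1)
  · exact max_le_max le_rfl (min_le_min le_rfl hpq.2)

theorem measurable_squareClamp : Measurable squareClamp := by
  refine measurable_pi_lambda _ fun i => ?_
  fin_cases i
  · exact measurable_const.max (measurable_const.min measurable_fst)
  · exact measurable_const.max (measurable_const.min measurable_snd)

theorem squareClamp_finTwoArrow {x : Fin 2 → ℝ} (hx : x ∈ unitSquare) :
    squareClamp (MeasurableEquiv.finTwoArrow x) = x := by
  have h₀ : ∀ i, 0 ≤ x i := hx.1
  have h₁ : ∀ i, x i ≤ 1 := hx.2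
  ext i
  fin_cases i <;> simp [squareClamp, h₀, h₁]

theorem sqE_eq_integral_prod (f : (Fin 2 → ℝ) → ℝ) :
    sqE f = ∫ p, f (squareClamp p) ∂((volume.restrict (Set.Icc (0 : ℝ) 1)).prod
      (volume.restrict (Set.Icc (0 : ℝ) 1))) := by
  have hpre : MeasurableEquiv.finTwoArrow ⁻¹' (Set.Icc (0 : ℝ) 1 ×ˢ Set.Icc (0 : ℝ) 1) =
      unitSquare := by
    ext x
    simp [unitSquare, Set.mem_Icc, Pi.le_def, Fin.forall_fin_two, and_and_and_comm]
  rw [Measure.prod_restrict, ← Measure.volume_eq_prod,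
    ← (volume_preserving_finTwoArrow ℝ).setIntegral_preimage_emb
      MeasurableEquiv.finTwoArrow.measurableEmbedding, hpre, sqE]
  exact setIntegral_congr_fun measurableSet_Icc fun x hx => by
    simp only [squareClamp_finTwoArrow hx]

/-- If `f, g, h` are nonnegative, monotone decreasing, Lebesgue-measurable
functions on the unit square `[0,1]²`, then
`E₃(f,g,h) = 2E(fgh) + E(f)E(g)E(h) − E(f)E(gh) − E(g)E(fh) − E(h)E(fg) ≥ 0`. -/
theorem stmt_0 (f g h : (Fin 2 → ℝ) → ℝ)
    (hfmeas : Measurable f) (hgmeas : Measurable g) (hhmeas : Measurable h)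
    (hfpos : ∀ x ∈ unitSquare, 0 ≤ f x)
    (hgpos : ∀ x ∈ unitSquare, 0 ≤ g x)
    (hhpos : ∀ x ∈ unitSquare, 0 ≤ h x)
    (hfmono : ∀ x ∈ unitSquare, ∀ y ∈ unitSquare, x ≤ y → f y ≤ f x)
    (hgmono : ∀ x ∈ unitSquare, ∀ y ∈ unitSquare, x ≤ y → g y ≤ g x)
    (hhmono : ∀ x ∈ unitSquare, ∀ y ∈ unitSquare, x ≤ y → h y ≤ h x) :
    0 ≤ 2 * sqE (fun x => f x * g x * h x) + sqE f * sqE g * sqE h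
      - sqE f * sqE (fun x => g x * h x)
      - sqE g * sqE (fun x => f x * h x)
      - sqE h * sqE (fun x => f x * g x) := by
  have zero_mem : (0 : Fin 2 → ℝ) ∈ unitSquare := ⟨le_rfl, zero_le_one⟩
  have : IsProbabilityMeasure (volume.restrict (Set.Icc (0 : ℝ) 1)) := ⟨by simp⟩
  have anti : ∀ {φ : (Fin 2 → ℝ) → ℝ},
      (∀ x ∈ unitSquare, ∀ y ∈ unitSquare, x ≤ y → φ y ≤ φ x) →
      Antitone fun p => φ (squareClamp p) := fun hφ p q hpq =>
    hφ _ (squareClamp_mem p) _ (squareClamp_mem q) (squareClamp_monotone hpq)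
  have le_zero : ∀ {φ : (Fin 2 → ℝ) → ℝ},
      (∀ x ∈ unitSquare, ∀ y ∈ unitSquare, x ≤ y → φ y ≤ φ x) →
      ∀ p, φ (squareClamp p) ≤ φ 0 := fun hφ p =>
    hφ _ zero_mem _ (squareClamp_mem p) (squareClamp_mem p).1
  have key := corrThree_prod_nonneg (volume.restrict (Set.Icc (0 : ℝ) 1))
    (volume.restrict (Set.Icc (0 : ℝ) 1)) (anti hfmono) (anti hgmono) (anti hhmono)
    (fun p => hfpos _ (squareClamp_mem p)) (fun p => hgpos _ (squareClamp_mem p))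
    (fun p => hhpos _ (squareClamp_mem p)) (hfmeas.comp measurable_squareClamp)
    (hgmeas.comp measurable_squareClamp) (hhmeas.comp measurable_squareClamp)
    (C := max (f 0) (max (g 0) (h 0)))
    (fun p => (le_zero hfmono p).trans (le_max_left _ _))
    (fun p => (le_zero hgmono p).trans ((le_max_left _ _).trans (le_max_right _ _)))
    (fun p => (le_zero hhmono p).trans ((le_max_right _ _).trans (le_max_right _ _)))
  simpa only [corrThree, sqE_eq_integral_prod] using key
end

section
/- Let k, n ≥ 1 and for each 1 ≤ i ≤ n let f^i be the characteristic function of a k-rectangle R_i = [0, r_{i,1}] × ⋯ × [0, r_{i,k}] ⊆ [0,1]^k, where 0 ≤ r_{i,j} ≤ 1. Then, with respect to Lebesgue measure on [0,1]^k, E_n(f^1, …, f^n) ≥ 0. -/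
open MeasureTheory

/-- The orbits (cycles, counting fixed points as 1-cycles) of a permutation `σ`
of a finite index type, as a finset of finsets. -/
def permOrbits {ι : Type*} [Fintype ι] [DecidableEq ι] (σ : Equiv.Perm ι) : Finset (Finset ι) :=
  Finset.univ.image fun x => Finset.univ.filter fun y => σ.SameCycle x y

/-- `E_σ(f¹,…,fⁿ) = ∏_{O orbit of σ} E(∏_{i ∈ O} fⁱ)`, the expectation being the
integral with respect to `μ`. -/
noncomputable def permE {Ω : Type*} [MeasurableSpace Ω] (μ : Measure Ω)
    {ι : Type*} [Fintype ι] [DecidableEq ι] (f : ι → Ω → ℝ) (σ : Equiv.Perm ι) : ℝ :=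
  ∏ O ∈ permOrbits σ, ∫ ω, (∏ i ∈ O, f i ω) ∂μ

/-- Sahi's functional `E_n(f¹,…,fⁿ) = ∑_{σ ∈ S_n} (−1)^{C_σ − 1} E_σ(f¹,…,fⁿ)`,
where `C_σ` is the number of orbits of `σ`. -/
noncomputable def En {Ω : Type*} [MeasurableSpace Ω] (μ : Measure Ω)
    {ι : Type*} [Fintype ι] [DecidableEq ι] (f : ι → Ω → ℝ) : ℝ :=
  ∑ σ : Equiv.Perm ι, (-1 : ℝ) ^ ((permOrbits σ).card - 1) * permE μ f σ

section PermOrbits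

variable {ι : Type*} [Fintype ι] [DecidableEq ι]

lemma mem_permOrbits {σ : Equiv.Perm ι} {O : Finset ι} :
    O ∈ permOrbits σ ↔ ∃ x, (Finset.univ.filter fun y => σ.SameCycle x y) = O := by
  simp [permOrbits]

lemma nonempty_of_mem_permOrbits {σ : Equiv.Perm ι} {O : Finset ι} (hO : O ∈ permOrbits σ) :
    O.Nonempty := by
  obtain ⟨x, rfl⟩ := mem_permOrbits.1 hO
  exact ⟨x, by simp [Equiv.Perm.SameCycle.refl]⟩

lemma permOrbits_pairwiseDisjoint (σ : Equiv.Perm ι) :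
    (permOrbits σ : Set (Finset ι)).PairwiseDisjoint id := by
  intro A hA B hB hAB
  obtain ⟨x, rfl⟩ := mem_permOrbits.1 hA
  obtain ⟨y, rfl⟩ := mem_permOrbits.1 hB
  refine Finset.disjoint_left.2 fun z hz hz' => hAB ?_
  simp only [id, Finset.mem_filter, Finset.mem_univ, true_and] at hz hz'
  ext t
  simp only [Finset.mem_filter, Finset.mem_univ, true_and]
  exact ⟨fun h => hz'.trans (hz.symm.trans h), fun h => hz.trans (hz'.symm.trans h)⟩

lemma biUnion_permOrbits (σ : Equiv.Perm ι) : (permOrbits σ).biUnion id = Finset.univ := by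
  refine Finset.eq_univ_of_forall fun x => Finset.mem_biUnion.2 ?_
  exact ⟨_, mem_permOrbits.2 ⟨x, rfl⟩, by simp [Equiv.Perm.SameCycle.refl]⟩

lemma prod_permOrbits_prod (σ : Equiv.Perm ι) (x : ι → ℝ) :
    ∏ O ∈ permOrbits σ, ∏ i ∈ O, x i = ∏ i, x i := by
  rw [← biUnion_permOrbits σ, Finset.prod_biUnion (permOrbits_pairwiseDisjoint σ)]
  rfl

lemma permOrbits_eq_union (σ : Equiv.Perm ι) :
    permOrbits σ = σ.cycleFactorsFinset.image Equiv.Perm.support ∪ σ.supportᶜ.image singleton := by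
  have hfix : ∀ x, σ x = x → (Finset.univ.filter fun y => σ.SameCycle x y) = {x} := by
    intro x hx
    ext y
    simp only [Finset.mem_filter, Finset.mem_univ, true_and, Finset.mem_singleton]
    refine ⟨fun ⟨n, hn⟩ => ?_, fun h => h ▸ .refl _ _⟩
    rw [Equiv.Perm.zpow_apply_eq_self_of_apply_eq_self hx] at hn
    exact hn.symm
  have hmov : ∀ x, σ x ≠ x →
      (Finset.univ.filter fun y => σ.SameCycle x y) = (σ.cycleOf x).support := by
    intro x hx
    ext y
    simp [Equiv.Perm.mem_support_cycleOf_iff' hx]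
  ext O
  simp only [mem_permOrbits, Finset.mem_union, Finset.mem_image, Finset.mem_compl,
    Equiv.Perm.mem_support, not_not]
  constructor
  · rintro ⟨x, rfl⟩
    by_cases hx : σ x = x
    · exact Or.inr ⟨x, hx, (hfix x hx).symm⟩
    · exact Or.inl ⟨σ.cycleOf x, Equiv.Perm.cycleOf_mem_cycleFactorsFinset_iff.2
        (Equiv.Perm.mem_support.2 hx), (hmov x hx).symm⟩
  · rintro (⟨c, hc, rfl⟩ | ⟨x, hx, rfl⟩)
    · obtain ⟨x, hx⟩ := (Equiv.Perm.mem_cycleFactorsFinset_iff.1 hc).1.nonempty_support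
      have hxσ := Equiv.Perm.mem_support.1 (Equiv.Perm.mem_cycleFactorsFinset_support_le hc hx)
      exact ⟨x, by rw [hmov x hxσ, ← Equiv.Perm.cycle_is_cycleOf hx hc]⟩
    · exact ⟨x, hfix x hx⟩

lemma card_permOrbits (σ : Equiv.Perm ι) :
    (permOrbits σ).card = σ.cycleType.card + σ.supportᶜ.card := by
  rw [permOrbits_eq_union, Finset.card_union_of_disjoint, Finset.card_image_of_injOn,
    Finset.card_image_of_injective _ Finset.singleton_injective, Equiv.Perm.cycleType_def,
    Multiset.card_map, Finset.card_val]
  · intro c hc d hd hcd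
    obtain ⟨x, hx⟩ := (Equiv.Perm.mem_cycleFactorsFinset_iff.1 hc).1.nonempty_support
    rw [Equiv.Perm.cycle_is_cycleOf hx hc,
      Equiv.Perm.cycle_is_cycleOf (c := d) (show x ∈ d.support from hcd ▸ hx) hd]
  · refine Finset.disjoint_left.2 fun O hO hO' => ?_
    obtain ⟨c, hc, rfl⟩ := Finset.mem_image.1 hO
    obtain ⟨x, -, hx⟩ := Finset.mem_image.1 hO'
    have := (Equiv.Perm.mem_cycleFactorsFinset_iff.1 hc).1.two_le_card_support
    rw [← hx, Finset.card_singleton] at this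
    omega

lemma neg_one_pow_card_permOrbits (σ : Equiv.Perm ι) :
    (-1 : ℝ) ^ (permOrbits σ).card = (-1) ^ Fintype.card ι * ((Equiv.Perm.sign σ : ℤ) : ℝ) := by
  have hcard : σ.support.card + σ.supportᶜ.card = Fintype.card ι := Finset.card_add_card_compl _
  rw [Equiv.Perm.sign_of_cycleType, Equiv.Perm.sum_cycleType, card_permOrbits, ← hcard]
  push_cast
  simp only [pow_add]
  have h : ((-1 : ℝ) ^ σ.support.card) * (-1) ^ σ.support.card = 1 := by
    rw [← mul_pow]; simp
  linear_combination (-(-1 : ℝ) ^ σ.cycleType.card * (-1) ^ σ.supportᶜ.card) * h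

lemma sum_sign_eq_zero [Nontrivial ι] :
    ∑ σ : Equiv.Perm ι, ((Equiv.Perm.sign σ : ℤ) : ℝ) = 0 := by
  obtain ⟨a, b, hab⟩ := exists_pair_ne ι
  have h : (Matrix.of fun _ _ : ι => (1 : ℝ)).det = 0 := Matrix.det_zero_of_row_eq hab rfl
  simpa [Matrix.det_apply'] using h

end PermOrbits

/-- The sum over all permutations of the product of the weights of the orbits. -/
noncomputable def orbitSum {ι : Type*} [Fintype ι] [DecidableEq ι] (w : Finset ι → ℝ) : ℝ :=
  ∑ σ : Equiv.Perm ι, ∏ O ∈ permOrbits σ, w O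

section OrbitSum

variable {ι : Type*} [Fintype ι] [DecidableEq ι]

lemma orbitSum_neg_prod_eq_zero [Nontrivial ι] (x : ι → ℝ) :
    orbitSum (fun O => -∏ i ∈ O, x i) = 0 := by
  have h : ∀ σ : Equiv.Perm ι, ∏ O ∈ permOrbits σ, (-∏ i ∈ O, x i) =
      ((-1) ^ Fintype.card ι * ∏ i, x i) * ((Equiv.Perm.sign σ : ℤ) : ℝ) := by
    intro σ
    rw [Finset.prod_neg, prod_permOrbits_prod, neg_one_pow_card_permOrbits]
    ring
  rw [orbitSum, Finset.sum_congr rfl fun σ _ => h σ, ← Finset.mul_sum, sum_sign_eq_zero, mul_zero]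

lemma sameCycle_subtypeCongr_left {α : Type*} [DecidableEq α] {S : Finset α}
    (p : Equiv.Perm {x // x ∈ S}) (q : Equiv.Perm {x // x ∉ S}) (x : {x // x ∈ S}) (y : α) :
    (p.subtypeCongr q).SameCycle x y ↔ ∃ h : y ∈ S, p.SameCycle x ⟨y, h⟩ := by
  have hpow : ∀ n : ℤ, ((p.subtypeCongr q) ^ n) x = (p ^ n) x := by
    intro n
    have := map_zpow (Equiv.Perm.subtypeCongrHom (· ∈ S)) (p, q) n
    change (p ^ n).subtypeCongr (q ^ n) = (p.subtypeCongr q) ^ n at this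
    rw [← this, Equiv.Perm.subtypeCongr.left_apply_subtype]
  constructor
  · rintro ⟨n, hn⟩
    rw [hpow] at hn
    subst hn
    exact ⟨((p ^ n) x).2, n, rfl⟩
  · rintro ⟨h, n, hn⟩
    exact ⟨n, by rw [hpow, hn]⟩

lemma sameCycle_subtypeCongr_right {α : Type*} [DecidableEq α] {S : Finset α}
    (p : Equiv.Perm {x // x ∈ S}) (q : Equiv.Perm {x // x ∉ S}) (x : {x // x ∉ S}) (y : α) :
    (p.subtypeCongr q).SameCycle x y ↔ ∃ h : y ∉ S, q.SameCycle x ⟨y, h⟩ := by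
  have hpow : ∀ n : ℤ, ((p.subtypeCongr q) ^ n) x = (q ^ n) x := by
    intro n
    have := map_zpow (Equiv.Perm.subtypeCongrHom (· ∈ S)) (p, q) n
    change (p ^ n).subtypeCongr (q ^ n) = (p.subtypeCongr q) ^ n at this
    rw [← this, Equiv.Perm.subtypeCongr.right_apply_subtype]
  constructor
  · rintro ⟨n, hn⟩
    rw [hpow] at hn
    subst hn
    exact ⟨((q ^ n) x).2, n, rfl⟩
  · rintro ⟨h, n, hn⟩
    exact ⟨n, by rw [hpow, hn]⟩

/-- The permutations of a finite type with a single orbit (or none). -/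
def cyclicPerms (α : Type*) [Fintype α] [DecidableEq α] : Finset (Equiv.Perm α) :=
  Finset.univ.filter fun p => ∀ x y, p.SameCycle x y

lemma permOrbits_subtypeCongr {S : Finset ι} {a : ι} (ha : a ∈ S)
    {p : Equiv.Perm {x // x ∈ S}} (hp : p ∈ cyclicPerms {x // x ∈ S})
    (q : Equiv.Perm {x // x ∉ S}) :
    permOrbits (p.subtypeCongr q) =
      insert S ((permOrbits q).image (Finset.map (Function.Embedding.subtype _))) := by
  have hp' : ∀ x y, p.SameCycle x y := by simpa [cyclicPerms] using hp
  have hleft : ∀ x ∈ S, (Finset.univ.filter fun y => (p.subtypeCongr q).SameCycle x y) = S := by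
    intro x hx
    ext y
    simp [sameCycle_subtypeCongr_left p q ⟨x, hx⟩ y, hp']
  have hright : ∀ x : {x // x ∉ S},
      (Finset.univ.filter fun y => (p.subtypeCongr q).SameCycle x y) =
        (Finset.univ.filter fun y => q.SameCycle x y).map (Function.Embedding.subtype _) := by
    intro x
    ext y
    simp [sameCycle_subtypeCongr_right p q x y]
  ext O
  simp only [mem_permOrbits, Finset.mem_insert, Finset.mem_image]
  constructor
  · rintro ⟨x, rfl⟩
    by_cases hx : x ∈ S
    · exact Or.inl (hleft x hx)
    · exact Or.inr ⟨_, ⟨⟨x, hx⟩, rfl⟩, (hright ⟨x, hx⟩).symm⟩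
  · rintro (rfl | ⟨_, ⟨x, rfl⟩, rfl⟩)
    · exact ⟨a, hleft a ha⟩
    · exact ⟨x, hright x⟩

lemma prod_permOrbits_subtypeCongr {S : Finset ι} {a : ι} (ha : a ∈ S)
    {p : Equiv.Perm {x // x ∈ S}} (hp : p ∈ cyclicPerms {x // x ∈ S})
    (q : Equiv.Perm {x // x ∉ S}) (w : Finset ι → ℝ) :
    ∏ O ∈ permOrbits (p.subtypeCongr q), w O =
      w S * ∏ O ∈ permOrbits q, w (O.map (Function.Embedding.subtype _)) := by
  rw [permOrbits_subtypeCongr ha hp, Finset.prod_insert, Finset.prod_image]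
  · exact fun _ _ _ _ h => Finset.map_injective _ h
  · intro h
    obtain ⟨O, -, hO⟩ := Finset.mem_image.1 h
    obtain ⟨y, -, hy⟩ := Finset.mem_map.1 (hO.symm ▸ ha)
    subst hy
    exact y.2 ha

lemma sum_filter_orbit_eq {S : Finset ι} {a : ι} (ha : a ∈ S) (w : Finset ι → ℝ) :
    ∑ σ : Equiv.Perm ι with (Finset.univ.filter fun y => σ.SameCycle a y) = S,
      ∏ O ∈ permOrbits σ, w O =
    (cyclicPerms {x // x ∈ S}).card * (w S *
      orbitSum fun O : Finset {x // x ∉ S} => w (O.map (Function.Embedding.subtype _))) := by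
  have key : ∑ pq ∈ cyclicPerms {x // x ∈ S} ×ˢ (Finset.univ : Finset (Equiv.Perm {x // x ∉ S})),
      (w S * ∏ O ∈ permOrbits pq.2, w (O.map (Function.Embedding.subtype _))) =
      ∑ σ : Equiv.Perm ι with (Finset.univ.filter fun y => σ.SameCycle a y) = S,
        ∏ O ∈ permOrbits σ, w O := by
    refine Finset.sum_bij (fun pq _ => pq.1.subtypeCongr pq.2) ?_ ?_ ?_ ?_
    · rintro ⟨p, q⟩ h
      have hp : ∀ x y, p.SameCycle x y := by simpa [cyclicPerms] using h
      simp only [Finset.mem_filter, Finset.mem_univ, true_and]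
      ext y
      simp [sameCycle_subtypeCongr_left p q ⟨a, ha⟩ y, hp]
    · intro x _ y _ h
      exact Equiv.Perm.subtypeCongrHom_injective (· ∈ S) h
    · intro σ hσ
      simp only [Finset.mem_filter, Finset.mem_univ, true_and] at hσ
      have hmem : ∀ x, x ∈ S ↔ σ.SameCycle a x := by
        intro x; rw [← hσ]; simp
      have hinv : ∀ x, σ x ∈ S ↔ x ∈ S := by
        intro x; rw [hmem, hmem, Equiv.Perm.sameCycle_apply_right]
      refine ⟨(σ.subtypePerm hinv, σ.subtypePerm fun x => not_congr (hinv x)), ?_, ?_⟩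
      · simp only [cyclicPerms, Finset.mem_product, Finset.mem_filter, Finset.mem_univ, true_and,
          and_true]
        intro x y
        rw [Equiv.Perm.sameCycle_subtypePerm]
        exact ((hmem x).1 x.2).symm.trans ((hmem y).1 y.2)
      · ext x
        by_cases hx : x ∈ S
        · simp [Equiv.Perm.subtypeCongr.left_apply, hx]
        · simp [Equiv.Perm.subtypeCongr.right_apply, hx]
    · rintro ⟨p, q⟩ h
      exact (prod_permOrbits_subtypeCongr ha (Finset.mem_product.1 h).1 q w).symm
  rw [← key, Finset.sum_product]
  simp only [← Finset.mul_sum, Finset.sum_const, nsmul_eq_mul]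
  exact mul_left_comm _ _ _

/-- Expansion of `orbitSum` according to the orbit of a given element. -/
lemma orbitSum_eq_sum_orbit (a : ι) (w : Finset ι → ℝ) :
    orbitSum w = ∑ S : Finset ι with a ∈ S, (cyclicPerms {x // x ∈ S}).card * (w S *
      orbitSum fun O : Finset {x // x ∉ S} => w (O.map (Function.Embedding.subtype _))) := by
  rw [orbitSum, ← Finset.sum_fiberwise_of_maps_to
    (g := fun σ : Equiv.Perm ι => Finset.univ.filter fun y => σ.SameCycle a y)
    (t := Finset.univ.filter fun S => a ∈ S) (by simp [Equiv.Perm.SameCycle.refl])]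
  refine Finset.sum_congr rfl fun S hS => sum_filter_orbit_eq (by simpa using hS) w

/-- Raising the weights of the proper subsets containing `a` can only increase
`orbitSum (-w)`, provided that the same sums over proper subsets are nonpositive. -/
lemma orbitSum_neg_le_orbitSum_neg {w w' : Finset ι → ℝ} (a : ι)
    (hout : ∀ S, a ∉ S → w S = w' S) (huniv : w Finset.univ = w' Finset.univ)
    (hle : ∀ S, w S ≤ w' S)
    (hsub : ∀ S : Finset ι, a ∈ S → S ≠ Finset.univ → orbitSum (fun O : Finset {x // x ∉ S} =>
      -w (O.map (Function.Embedding.subtype _))) ≤ 0) :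
    orbitSum (fun O => -w O) ≤ orbitSum fun O => -w' O := by
  rw [orbitSum_eq_sum_orbit a, orbitSum_eq_sum_orbit a]
  refine Finset.sum_le_sum fun S hS => ?_
  have ha : a ∈ S := by simpa using hS
  refine mul_le_mul_of_nonneg_left ?_ (Nat.cast_nonneg _)
  by_cases hSu : S = Finset.univ
  · subst hSu
    rw [huniv]
    refine le_of_eq (congrArg _ (congrArg _ (funext fun O => ?_)))
    rw [hout]
    simp
  · have heq : (fun O : Finset {x // x ∉ S} => -w' (O.map (Function.Embedding.subtype _))) =
        fun O => -w (O.map (Function.Embedding.subtype _)) := by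
      funext O
      rw [hout]
      simp [ha]
    rw [heq]
    exact mul_le_mul_of_nonpos_right (neg_le_neg (hle S)) (hsub S ha hSu)

end OrbitSum

/-- The volume of the intersection of the rectangles with side lengths `r i`, `i ∈ O`. -/
noncomputable def rectWeight {ι κ : Type*} [Fintype κ] (r : ι → κ → Set.Icc (0 : ℝ) 1)
    (O : Finset ι) : ℝ :=
  ∏ j, ((O.inf fun i => r i j : Set.Icc (0 : ℝ) 1) : ℝ)

section RectWeight

variable {ι κ : Type*} [Fintype κ]

lemma rectWeight_nonneg (r : ι → κ → Set.Icc (0 : ℝ) 1) (O : Finset ι) : 0 ≤ rectWeight r O :=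
  Finset.prod_nonneg fun j _ => (O.inf fun i => r i j).2.1

lemma rectWeight_mono {r r' : ι → κ → Set.Icc (0 : ℝ) 1} (h : r ≤ r') (O : Finset ι) :
    rectWeight r O ≤ rectWeight r' O :=
  Finset.prod_le_prod (fun j _ => (O.inf fun i => r i j).2.1) fun j _ =>
    Subtype.coe_le_coe.2 (Finset.inf_mono_fun fun i _ => h i j)

lemma inf_eq_prod_of_subsingleton [DecidableEq ι] (x : ι → Set.Icc (0 : ℝ) 1)
    (hx : ∀ i i', x i ≠ ⊤ → x i' ≠ ⊤ → i = i') (O : Finset ι) :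
    ((O.inf x : Set.Icc (0 : ℝ) 1) : ℝ) = ∏ i ∈ O, (x i : ℝ) := by
  induction O using Finset.induction_on with
  | empty => simp
  | insert a O ha ih =>
    rw [Finset.inf_insert, Finset.prod_insert ha, ← ih]
    by_cases h : x a = ⊤
    · simp [h]
    · have : O.inf x = ⊤ := by
        rw [Finset.inf_eq_top_iff]
        intro i hi
        by_contra hne
        exact ha (hx a i h hne ▸ hi)
      simp [this]

lemma rectWeight_update_of_notMem [DecidableEq ι]
    (r : ι → κ → Set.Icc (0 : ℝ) 1) {a : ι} {O : Finset ι} (ha : a ∉ O)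
    (v : κ → Set.Icc (0 : ℝ) 1) : rectWeight (Function.update r a v) O = rectWeight r O := by
  refine Finset.prod_congr rfl fun j _ => congrArg _ (Finset.inf_congr rfl fun i hi => ?_)
  rw [Function.update_of_ne (ne_of_mem_of_not_mem hi ha)]

/-- Removing the upper bound `r a j` does not change the intersection of all the rectangles
if another rectangle is at most as wide in direction `j`. -/
lemma rectWeight_update_top_univ [Fintype ι] [DecidableEq ι] [DecidableEq κ]
    (r : ι → κ → Set.Icc (0 : ℝ) 1) {a b : ι} (hab : b ≠ a) {j : κ} (h : r b j ≤ r a j) :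
    rectWeight (Function.update r a (Function.update (r a) j ⊤)) Finset.univ =
      rectWeight r Finset.univ := by
  refine Finset.prod_congr rfl fun l _ => congrArg _ (le_antisymm ?_ ?_)
  · refine Finset.le_inf fun i _ => ?_
    by_cases hi : i = a
    · subst hi
      by_cases hl : l = j
      · subst hl
        refine (Finset.inf_le (Finset.mem_univ b)).trans ?_
        simpa [hab] using h
      · refine (Finset.inf_le (Finset.mem_univ i)).trans ?_
        simp [hl]
    · refine (Finset.inf_le (Finset.mem_univ i)).trans ?_
      simp [hi]
  · refine Finset.inf_mono_fun fun i _ => ?_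
    by_cases hi : i = a
    · subst hi
      by_cases hl : l = j
      · subst hl; simp
      · simp [hl]
    · simp [hi]

lemma orbitSum_neg_rectWeight_nonpos_of_subsingleton [Fintype ι] [DecidableEq ι] [Nonempty ι]
    (r : ι → κ → Set.Icc (0 : ℝ) 1) (hr : ∀ j i i', r i j ≠ ⊤ → r i' j ≠ ⊤ → i = i') :
    orbitSum (fun O => -rectWeight r O) ≤ 0 := by
  rcases subsingleton_or_nontrivial ι with _ | _
  · refine Finset.sum_nonpos fun σ _ => ?_
    have hσ : permOrbits σ = {Finset.univ} := by
      ext O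
      obtain ⟨x⟩ := ‹Nonempty ι›
      have h : ∀ x, (Finset.univ.filter fun y => σ.SameCycle x y) = Finset.univ := fun x =>
        Finset.filter_true_of_mem fun y _ => Subsingleton.elim x y ▸ .refl _ _
      simp [mem_permOrbits, h, eq_comm]
    rw [hσ, Finset.prod_singleton]
    exact neg_nonpos.2 (rectWeight_nonneg r _)
  · have : rectWeight r = fun O => ∏ i ∈ O, ∏ j, (r i j : ℝ) := by
      funext O
      rw [rectWeight, Finset.prod_comm]
      exact Finset.prod_congr rfl fun j _ => inf_eq_prod_of_subsingleton _ (hr j) O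
    rw [this]
    exact (orbitSum_neg_prod_eq_zero _).le

end RectWeight

theorem orbitSum_neg_rectWeight_nonpos {κ : Type*} [Fintype κ] [DecidableEq κ] (n : ℕ) :
    ∀ {ι : Type*} [Fintype ι] [DecidableEq ι] [Nonempty ι] (r : ι → κ → Set.Icc (0 : ℝ) 1),
      Fintype.card ι = n → orbitSum (fun O => -rectWeight r O) ≤ 0 := by
  induction n using Nat.strong_induction_on with
  | _ n ihn =>
  intro ι _ _ _ r hn
  induction hN : (Finset.univ.filter fun q : ι × κ => r q.1 q.2 ≠ ⊤).card
    using Nat.strong_induction_on generalizing r with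
  | _ N ihN =>
  by_cases hex : ∃ (j : κ) (a b : ι), b ≠ a ∧ r a j ≠ ⊤ ∧ r b j ≤ r a j
  · obtain ⟨j, a, b, hab, htop, hle⟩ := hex
    set r' := Function.update r a (Function.update (r a) j ⊤) with hr'
    have hrr' : r ≤ r' := by
      rw [hr', le_update_iff]
      refine ⟨?_, fun _ _ => le_rfl⟩
      rw [le_update_iff]
      exact ⟨le_top, fun _ _ => le_rfl⟩
    have hsub : (Finset.univ.filter fun q : ι × κ => r' q.1 q.2 ≠ ⊤) ⊂
        Finset.univ.filter fun q : ι × κ => r q.1 q.2 ≠ ⊤ := by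
      refine Finset.ssubset_iff_of_subset ?_ |>.2 ⟨(a, j), by simpa using htop, by simp [hr']⟩
      intro q hq
      simp only [Finset.mem_filter, Finset.mem_univ, true_and] at hq ⊢
      exact fun h => hq (top_le_iff.1 (h ▸ hrr' q.1 q.2))
    refine le_trans ?_ (ihN _ (hN ▸ Finset.card_lt_card hsub) r' rfl)
    refine orbitSum_neg_le_orbitSum_neg a (fun S ha => (rectWeight_update_of_notMem r ha _).symm)
      (rectWeight_update_top_univ r hab hle).symm (rectWeight_mono hrr') fun S ha hS => ?_
    obtain ⟨y, hy⟩ : ∃ y, y ∉ S := by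
      by_contra! h
      exact hS (Finset.eq_univ_of_forall h)
    have : Nonempty {x // x ∉ S} := ⟨⟨y, hy⟩⟩
    have hcard : Fintype.card {x // x ∉ S} < n :=
      hn ▸ Fintype.card_subtype_lt (x := a) (by simpa using ha)
    have := ihn _ hcard (fun i : {x // x ∉ S} => r i) rfl
    simpa [rectWeight, Finset.inf_map, Function.comp_def] using this
  · push Not at hex
    refine orbitSum_neg_rectWeight_nonpos_of_subsingleton r fun j i i' hi hi' => ?_
    by_contra hne
    exact lt_asymm (hex j i i' (Ne.symm hne) hi) (hex j i' i hne hi')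

lemma En_eq_neg_orbitSum {Ω : Type*} [MeasurableSpace Ω] (μ : Measure Ω) {ι : Type*} [Fintype ι]
    [DecidableEq ι] [Nonempty ι] (f : ι → Ω → ℝ) :
    En μ f = -orbitSum fun O => -∫ ω, (∏ i ∈ O, f i ω) ∂μ := by
  rw [En, orbitSum, ← Finset.sum_neg_distrib]
  refine Finset.sum_congr rfl fun σ _ => ?_
  have hpos : 0 < (permOrbits σ).card :=
    Finset.card_pos.2 ⟨_, mem_permOrbits.2 ⟨Classical.arbitrary ι, rfl⟩⟩
  obtain ⟨m, hm⟩ := Nat.exists_eq_succ_of_ne_zero hpos.ne'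
  rw [Finset.prod_neg, permE, hm, Nat.succ_sub_one, pow_succ]
  ring

lemma integral_prod_indicator_Icc {ι κ : Type*} [Fintype κ] (r : ι → κ → Set.Icc (0 : ℝ) 1)
    {O : Finset ι} (hO : O.Nonempty) :
    ∫ x in Set.Icc (0 : κ → ℝ) 1,
      ∏ i ∈ O, Set.indicator (Set.Icc 0 fun j => (r i j : ℝ)) (fun _ => (1 : ℝ)) x =
      rectWeight r O := by
  set v : κ → ℝ := fun j => ((O.inf fun i => r i j : Set.Icc (0 : ℝ) 1) : ℝ) with hv
  have hle : ∀ x : κ → ℝ, x ≤ v ↔ ∀ i ∈ O, x ≤ fun j => (r i j : ℝ) := by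
    intro x
    constructor
    · exact fun h i hi j => (h j).trans (Subtype.coe_le_coe.2 (Finset.inf_le hi))
    · intro h j
      obtain ⟨i, hi, hij⟩ := Finset.exists_mem_eq_inf O hO fun i => r i j
      simpa only [hv, hij] using h i hi j
  have hfun : (fun x : κ → ℝ =>
      ∏ i ∈ O, Set.indicator (Set.Icc 0 fun j => (r i j : ℝ)) (fun _ => (1 : ℝ)) x) =
      Set.indicator (Set.Icc 0 v) fun _ => 1 := by
    funext x
    by_cases hx : x ∈ Set.Icc 0 v
    · rw [Set.indicator_of_mem hx]
      exact Finset.prod_eq_one fun i hi =>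
        Set.indicator_of_mem (Set.mem_Icc.2 ⟨hx.1, (hle x).1 hx.2 i hi⟩) _
    · rw [Set.indicator_of_notMem hx]
      obtain ⟨i, hi, hxi⟩ : ∃ i ∈ O, x ∉ Set.Icc 0 fun j => (r i j : ℝ) := by
        by_contra! h
        obtain ⟨i, hi⟩ := hO
        have hx0 := (h i hi).1
        exact hx ⟨hx0, (hle x).2 fun i hi => (h i hi).2⟩
      exact Finset.prod_eq_zero hi (Set.indicator_of_notMem hxi _)
  have hsub : Set.Icc 0 v ⊆ Set.Icc (0 : κ → ℝ) 1 :=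
    Set.Icc_subset_Icc_right fun j => (O.inf fun i => r i j).2.2
  have hv0 : 0 ≤ v := fun j => (O.inf fun i => r i j).2.1
  rw [hfun, setIntegral_indicator measurableSet_Icc, Set.inter_eq_self_of_subset_right hsub,
    setIntegral_const, smul_eq_mul, mul_one, measureReal_def, Real.volume_Icc_pi_toReal hv0]
  simp [rectWeight, hv]

/-- Let `k, n ≥ 1` and let `fⁱ` be the characteristic function of a
`k`-rectangle `Rᵢ = [0, r_{i,1}] × ⋯ × [0, r_{i,k}] ⊆ [0,1]^k`.  Then, with respect to
Lebesgue (probability) measure on `[0,1]^k`, `E_n(f¹,…,fⁿ) ≥ 0`. -/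
theorem stmt_9 (k n : ℕ) (hk : 1 ≤ k) (hn : 1 ≤ n)
    (r : Fin n → Fin k → ℝ) (hr0 : ∀ i j, 0 ≤ r i j) (hr1 : ∀ i j, r i j ≤ 1)
    (f : Fin n → (Fin k → ℝ) → ℝ)
    (hf : ∀ i, f i = Set.indicator (Set.Icc (0 : Fin k → ℝ) (r i)) fun _ => (1 : ℝ)) :
    0 ≤ En (volume.restrict (Set.Icc (0 : Fin k → ℝ) 1)) f := by
  have : Nonempty (Fin n) := ⟨⟨0, hn⟩⟩
  let r' : Fin n → Fin k → Set.Icc (0 : ℝ) 1 := fun i j => ⟨r i j, hr0 i j, hr1 i j⟩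
  have h : orbitSum (fun O => -∫ x in Set.Icc (0 : Fin k → ℝ) 1, ∏ i ∈ O, f i x) =
      orbitSum fun O => -rectWeight r' O := by
    refine Finset.sum_congr rfl fun σ _ => Finset.prod_congr rfl fun O hO => congrArg _ ?_
    rw [← integral_prod_indicator_Icc r' (nonempty_of_mem_permOrbits hO)]
    simp only [hf, r']
  rw [En_eq_neg_orbitSum, h]
  exact neg_nonneg.2 (orbitSum_neg_rectWeight_nonpos _ r' rfl)
end

section
/- Let n ≥ 1 and let f^1, …, f^n be nonnegative, monotone decreasing, Lebesgue-measurable functions on the unit square [0,1]^2. Then, with respect to Lebesgue measure on [0,1]^2, E_n(f^1, …, f^n) ≥ 0. -/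
open MeasureTheory

section Orbits

variable {ι κ : Type*} [Fintype ι] [DecidableEq ι] [Fintype κ] [DecidableEq κ]

theorem Equiv.Perm.SameCycle.map_of_forall {ι κ : Type*} {σ : Equiv.Perm κ} {τ : Equiv.Perm ι}
    {π : κ → ι} (h : ∀ x, τ.SameCycle (π x) (π (σ x))) {x y : κ} (hxy : σ.SameCycle x y) :
    τ.SameCycle (π x) (π y) := by
  obtain ⟨k, rfl⟩ := hxy
  induction k using Int.induction_on with
  | zero => exact Equiv.Perm.SameCycle.refl _ _
  | succ k ih =>
    refine ih.trans ?_
    have := h ((σ ^ (k : ℤ)) x)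
    rwa [← Equiv.Perm.mul_apply, ← zpow_one_add, add_comm] at this
  | pred k ih =>
    refine ih.trans (Equiv.Perm.SameCycle.symm ?_)
    have := h ((σ ^ (-(k : ℤ) - 1)) x)
    rwa [← Equiv.Perm.mul_apply, ← zpow_one_add, add_sub_cancel] at this

theorem filter_sameCycle_mem_permOrbits (σ : Equiv.Perm ι) (i : ι) :
    (Finset.univ.filter fun y => σ.SameCycle i y) ∈ permOrbits σ :=
  Finset.mem_image_of_mem _ (Finset.mem_univ i)

theorem eq_filter_sameCycle_of_mem_permOrbits {σ : Equiv.Perm ι} {i : ι} {O : Finset ι}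
    (hO : O ∈ permOrbits σ) (hi : i ∈ O) : O = Finset.univ.filter fun y => σ.SameCycle i y := by
  obtain ⟨x, -, rfl⟩ := Finset.mem_image.1 hO
  have hx : σ.SameCycle x i := by simpa using hi
  ext y
  simp only [Finset.mem_filter, Finset.mem_univ, true_and]
  exact ⟨hx.symm.trans, hx.trans⟩

theorem permOrbits_nonempty [Nonempty ι] (σ : Equiv.Perm ι) : (permOrbits σ).Nonempty :=
  Finset.univ_nonempty.image _

/-- Orbits of a permutation whose cycle relation is pulled back along a surjection. -/
theorem prod_permOrbits_of_surjective {π : κ → ι} (hπ : Function.Surjective π)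
    {σ : Equiv.Perm κ} {τ : Equiv.Perm ι}
    (h : ∀ x y, σ.SameCycle x y ↔ τ.SameCycle (π x) (π y)) (F : Finset κ → ℝ) :
    ∏ O ∈ permOrbits σ, F O = ∏ O ∈ permOrbits τ, F (Finset.univ.filter fun x => π x ∈ O) := by
  have himage : permOrbits σ =
      (permOrbits τ).image fun O => Finset.univ.filter fun x => π x ∈ O := by
    ext O
    simp only [permOrbits, Finset.mem_image, Finset.mem_univ, true_and, exists_exists_eq_and,
      Finset.mem_filter, h, hπ.exists]
  rw [himage, Finset.prod_image]
  intro O _ O' _ hOO'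
  ext i
  obtain ⟨x, rfl⟩ := hπ i
  simpa using Finset.ext_iff.1 hOO' x

end Orbits

section Sahi

variable {Ω ι κ α : Type*} [Fintype ι] [DecidableEq ι] [Fintype κ] [DecidableEq κ]
  [Fintype α] [DecidableEq α]

/-- Sahi's functional for an arbitrary linear expectation; it equals `-1` on the empty family. -/
noncomputable def sahi (L : (Ω → ℝ) →ₗ[ℝ] ℝ) (f : ι → Ω → ℝ) : ℝ :=
  -∑ σ : Equiv.Perm ι, ∏ O ∈ permOrbits σ, -L (∏ i ∈ O, f i)

variable (L : (Ω → ℝ) →ₗ[ℝ] ℝ)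

theorem sahi_comp_equiv (e : κ ≃ ι) (f : ι → Ω → ℝ) : sahi L (f ∘ e) = sahi L f := by
  unfold sahi
  congr 1
  refine Fintype.sum_equiv e.permCongr _ _ fun σ => ?_
  have h : ∀ x y, σ.SameCycle x y ↔ (e.permCongr σ).SameCycle (e x) (e y) := by
    refine fun x y => ⟨Equiv.Perm.SameCycle.map_of_forall fun z => ?_, fun hxy => ?_⟩
    · exact ⟨1, by simp [Equiv.permCongr_apply]⟩
    · simpa using hxy.map_of_forall (τ := σ) (π := e.symm) fun z =>
        ⟨1, by simp [Equiv.permCongr_apply]⟩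
  rw [prod_permOrbits_of_surjective e.surjective h]
  refine Finset.prod_congr rfl fun O _ => ?_
  congr 2
  exact Finset.prod_equiv e (by simp) (by simp)

theorem exists_linearMap_sahi_update (f : ι → Ω → ℝ) (i : ι) :
    ∃ Λ : (Ω → ℝ) →ₗ[ℝ] ℝ, ∀ g, sahi L (Function.update f i g) = Λ g := by
  have h : ∀ σ : Equiv.Perm ι, ∃ Λ : (Ω → ℝ) →ₗ[ℝ] ℝ, ∀ g,
      ∏ O ∈ permOrbits σ, -L (∏ j ∈ O, Function.update f i g j) = Λ g := by
    intro σ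
    set O := Finset.univ.filter fun y => σ.SameCycle i y with hO
    have hi : i ∈ O := by simp [hO, Equiv.Perm.SameCycle.refl]
    refine ⟨(∏ P ∈ (permOrbits σ).erase O, -L (∏ j ∈ P, f j)) •
      -(L ∘ₗ LinearMap.mulLeft ℝ (∏ j ∈ O.erase i, f j)), fun g => ?_⟩
    rw [← Finset.prod_erase_mul _ _ (filter_sameCycle_mem_permOrbits σ i), ← hO,
      ← Finset.prod_erase_mul _ _ hi]
    simp only [LinearMap.smul_apply, LinearMap.neg_apply, LinearMap.comp_apply,
      LinearMap.mulLeft_apply, smul_eq_mul, Function.update_self]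
    congr 1
    · refine Finset.prod_congr rfl fun P hP => ?_
      congr 2
      refine Finset.prod_congr rfl fun j hj => Function.update_of_ne ?_ _ _
      rintro rfl
      exact Finset.ne_of_mem_erase hP
        (eq_filter_sameCycle_of_mem_permOrbits (Finset.mem_of_mem_erase hP) hj)
    · congr 3
      exact Finset.prod_congr rfl fun j hj =>
        Function.update_of_ne (Finset.ne_of_mem_erase hj) _ _
  choose Λ hΛ using h
  exact ⟨-∑ σ, Λ σ, fun g => by simp [sahi, hΛ]⟩

theorem prod_permOrbits_optionCongr (τ : Equiv.Perm α) (F : Finset (Option α) → ℝ) :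
    ∏ O ∈ permOrbits (Equiv.optionCongr τ), F O =
      F {none} * ∏ O ∈ permOrbits τ, F (O.map Function.Embedding.some) := by
  set σ : Equiv.Perm (Option α) := Equiv.optionCongr τ with hσ
  have hnone : ∀ y, σ.SameCycle none y ↔ y = none := by
    refine fun y => ⟨fun h => ?_, fun h => h ▸ Equiv.Perm.SameCycle.refl _ _⟩
    exact (h.eq_of_left (by simp [Function.IsFixedPt, hσ])).symm
  have hsome : ∀ b c, σ.SameCycle (some b) (some c) ↔ τ.SameCycle b c := by
    refine fun b c => ⟨fun h => ?_, Equiv.Perm.SameCycle.map_of_forall fun z => ⟨1, by simp [hσ]⟩⟩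
    have := h.map_of_forall (τ := τ) (π := fun o => o.getD b) fun z => by
      cases z with
      | none => simp [hσ, Equiv.Perm.SameCycle.refl]
      | some z => exact ⟨1, by simp [hσ]⟩
    simpa using this
  have himage : permOrbits σ =
      insert {none} ((permOrbits τ).image fun O => O.map Function.Embedding.some) := by
    have key : ∀ b, (Finset.univ.filter fun y => σ.SameCycle (some b) y) =
        (Finset.univ.filter fun y => τ.SameCycle b y).map Function.Embedding.some := by
      intro b
      ext y
      cases y with
      | none =>
        simp [Equiv.Perm.sameCycle_comm.trans (hnone (some b))]
      | some c => simp [hsome]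
    have key' : (Finset.univ.filter fun y => σ.SameCycle none y) = {none} := by
      ext y
      simp [hnone]
    ext O
    simp only [permOrbits, Finset.mem_image, Finset.mem_univ, true_and, Option.exists, key, key',
      Finset.mem_insert, exists_exists_eq_and, eq_comm (a := O)]
  rw [himage, Finset.prod_insert, Finset.prod_image]
  · intro O _ P _ h
    exact Finset.map_injective _ h
  · intro h
    obtain ⟨O, -, hO⟩ := Finset.mem_image.1 h
    have : none ∈ O.map (Function.Embedding.some : α ↪ Option α) := by rw [hO]; simp
    simp at this

theorem prod_permOrbits_swap_mul_optionCongr (τ : Equiv.Perm α) (a : α)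
    (F : Finset (Option α) → ℝ) :
    ∏ O ∈ permOrbits (Equiv.swap none (some a) * Equiv.optionCongr τ), F O =
      ∏ O ∈ permOrbits τ, F (Finset.univ.filter fun x => x.getD a ∈ O) := by
  set σ : Equiv.Perm (Option α) := Equiv.swap none (some a) * Equiv.optionCongr τ with hσ
  have hσnone : σ none = some a := by simp [hσ]
  have hσsome : ∀ b, σ (some b) = if τ b = a then none else some (τ b) := by
    intro b
    split_ifs with h
    · simp [hσ, h]
    · simp [hσ, Equiv.swap_apply_of_ne_of_ne, h]
  have hself : ∀ x : Option α, σ.SameCycle x (some (x.getD a)) := by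
    intro x
    cases x with
    | none => exact ⟨1, by simp [hσnone]⟩
    | some b => exact Equiv.Perm.SameCycle.refl _ _
  refine prod_permOrbits_of_surjective (π := fun x => x.getD a) (fun b => ⟨some b, rfl⟩) ?_ F
  intro x y
  refine ⟨Equiv.Perm.SameCycle.map_of_forall (π := fun x : Option α => x.getD a)
    fun z => ?_, fun h => ?_⟩
  · cases z with
    | none => simp [hσnone, Equiv.Perm.SameCycle.refl]
    | some b =>
      refine ⟨1, ?_⟩
      rw [hσsome]
      split_ifs with hb <;> simp [hb]
  · have hmap : ∀ b, σ.SameCycle (some b) (some (τ b)) := by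
      intro b
      by_cases hb : τ b = a
      · exact ⟨2, by rw [zpow_two, Equiv.Perm.mul_apply, hσsome, if_pos hb, hσnone, hb]⟩
      · exact ⟨1, by rw [zpow_one, hσsome, if_neg hb]⟩
    exact ((hself x).trans (h.map_of_forall hmap)).trans (hself y).symm

/-- Sahi's recursion, expanding along the cycle containing the distinguished index. -/
theorem sahi_option (f : Option α → Ω → ℝ) :
    sahi L f = ∑ a, sahi L (Function.update (fun b => f (some b)) a (f none * f (some a))) -
      L (f none) * sahi L fun b => f (some b) := by
  have hsum : ∑ σ : Equiv.Perm (Option α), ∏ O ∈ permOrbits σ, -L (∏ i ∈ O, f i) =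
      ∑ x : Option α, ∑ τ : Equiv.Perm α,
        ∏ O ∈ permOrbits (Equiv.swap none x * Equiv.optionCongr τ), -L (∏ i ∈ O, f i) := by
    rw [← Fintype.sum_prod_type', ← Equiv.Perm.decomposeOption.symm.sum_comp]
    rfl
  have hfilter : ∀ (a : α) (O : Finset α),
      ∏ i ∈ Finset.univ.filter (fun x : Option α => x.getD a ∈ O), f i =
        ∏ b ∈ O, Function.update (fun b => f (some b)) a (f none * f (some a)) b := by
    intro a O
    have h : ∀ b, Function.update (fun b => f (some b)) a (f none * f (some a)) b =
        (if a = b then f none else 1) * f (some b) := by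
      intro b
      rcases eq_or_ne a b with rfl | hab
      · simp
      · simp [hab, hab.symm]
    simp only [h]
    rw [Finset.prod_mul_distrib, Finset.prod_ite_eq, Finset.prod_filter, Fintype.prod_option]
    congr 1
    simp
  simp only [sahi]
  rw [hsum, Fintype.sum_option]
  simp only [Equiv.swap_self, ← Equiv.Perm.one_def, one_mul,
    prod_permOrbits_swap_mul_optionCongr, hfilter, Finset.sum_neg_distrib]
  simp only [prod_permOrbits_optionCongr, Finset.prod_singleton,
    Finset.prod_map, Function.Embedding.some_apply, ← Finset.mul_sum]
  ring

end Sahi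

section Removal

variable {Ω ι : Type*} [Fintype ι] [DecidableEq ι] (L : (Ω → ℝ) →ₗ[ℝ] ℝ)

theorem sahi_eq_sum_sub (f : ι → Ω → ℝ) (i : ι) :
    sahi L f = ∑ a : {x // x ≠ i},
        sahi L (Function.update (fun b : {x // x ≠ i} => f b) a (f i * f a)) -
      L (f i) * sahi L fun b : {x // x ≠ i} => f b := by
  rw [← sahi_comp_equiv L (Equiv.optionSubtypeNe i) f, sahi_option]
  simp

theorem sahi_eq_zero_of_eq_zero {f : ι → Ω → ℝ} {i : ι} (h : f i = 0) : sahi L f = 0 := by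
  obtain ⟨Λ, hΛ⟩ := exists_linearMap_sahi_update L f i
  rw [← Function.update_eq_self i f, hΛ, h, map_zero]

theorem sahi_of_unique [Unique ι] (f : ι → Ω → ℝ) : sahi L f = L (f default) := by
  have : IsEmpty {x : ι // x ≠ default} := ⟨fun x => x.2 (Subsingleton.elim _ _)⟩
  rw [sahi_eq_sum_sub L f default]
  simp [sahi, permOrbits]

theorem sahi_of_eq_one {f : ι → Ω → ℝ} {i : ι} (h : f i = 1) :
    sahi L f = ((Fintype.card {x // x ≠ i} : ℝ) - L 1) * sahi L fun b : {x // x ≠ i} => f b := by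
  rw [sahi_eq_sum_sub L f i, h]
  have (a : {x // x ≠ i}) : Function.update (fun b : {x // x ≠ i} => f b) a (1 * f a) =
      fun b : {x // x ≠ i} => f b := by
    rw [one_mul]
    exact Function.update_eq_self a _
  simp only [this, Finset.sum_const, Finset.card_univ, nsmul_eq_mul]
  ring

end Removal

section Indicator

variable {Ω ι : Type*} [DecidableEq Ω] [Fintype ι] [DecidableEq ι]

/-- The real-valued characteristic function of a finite set. -/
def charFn (D : Finset Ω) : Ω → ℝ := fun p => if p ∈ D then 1 else 0

theorem charFn_union {D U : Finset Ω} (h : Disjoint D U) :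
    charFn (D ∪ U) = charFn D + ∑ p ∈ U, Pi.single p 1 := by
  ext q
  have : q ∈ D → q ∉ U := fun hq => Finset.disjoint_left.1 h hq
  by_cases hD : q ∈ D <;> by_cases hU : q ∈ U <;>
    simp_all [charFn, Finset.sum_apply, Pi.single_apply]

theorem charFn_eq_sum (D : Finset Ω) : charFn D = ∑ p ∈ D, Pi.single p 1 := by
  ext q
  simp [charFn, Finset.sum_apply, Pi.single_apply]

theorem charFn_univ [Fintype Ω] : charFn (Finset.univ : Finset Ω) = 1 := by
  ext q
  simp [charFn]

theorem single_mul_charFn (p : Ω) (D : Finset Ω) :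
    (Pi.single p 1 * charFn D : Ω → ℝ) = if p ∈ D then Pi.single p 1 else 0 := by
  ext q
  by_cases hq : q = p
  · subst hq
    by_cases h : q ∈ D <;> simp [charFn, h]
  · split_ifs <;> simp [hq]

variable (L : (Ω → ℝ) →ₗ[ℝ] ℝ)

theorem sahi_update_single (D : ι → Finset Ω) (i : ι) (p : Ω) :
    sahi L (Function.update (fun j => charFn (D j)) i (Pi.single p 1)) =
      ∑ a : {x // x ≠ i}, (if p ∈ D a then
        sahi L (Function.update (fun b : {x // x ≠ i} => charFn (D b)) a (Pi.single p 1)) else 0) -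
      L (Pi.single p 1) * sahi L fun b : {x // x ≠ i} => charFn (D b) := by
  have hne (b : {x // x ≠ i}) : Function.update (fun j => charFn (D j)) i (Pi.single p 1) b =
      charFn (D b) := Function.update_of_ne b.2 _ _
  rw [sahi_eq_sum_sub L _ i]
  simp only [hne, Function.update_self, single_mul_charFn]
  congr 1
  refine Finset.sum_congr rfl fun a _ => ?_
  split_ifs
  · rfl
  · exact sahi_eq_zero_of_eq_zero L (i := a) (Function.update_self _ _ _)

theorem sahi_update_union (D : ι → Finset Ω) (i : ι) {A U : Finset Ω} (h : Disjoint A U) :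
    sahi L (fun j => charFn (Function.update D i (A ∪ U) j)) =
      sahi L (fun j => charFn (Function.update D i A j)) +
        ∑ p ∈ U, sahi L (Function.update (fun j => charFn (D j)) i (Pi.single p 1)) := by
  have hcomm (B : Finset Ω) : (fun j => charFn (Function.update D i B j)) =
      Function.update (fun j => charFn (D j)) i (charFn B) := by
    ext1 j
    exact Function.apply_update (fun _ => charFn) D i B j
  obtain ⟨Λ, hΛ⟩ := exists_linearMap_sahi_update L (fun j => charFn (D j)) i
  simp only [hcomm, hΛ, charFn_union h, map_add, map_sum]

/-- Inserting a point mass depends only on which of the other sets contain the point. -/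
theorem sahi_update_single_congr {ι : Type} [Fintype ι] [DecidableEq ι] {p q : Ω}
    (hL : L (Pi.single p 1) = L (Pi.single q 1))
    (D : ι → Finset Ω) (i : ι) (h : ∀ j, j ≠ i → (p ∈ D j ↔ q ∈ D j)) :
    sahi L (Function.update (fun j => charFn (D j)) i (Pi.single p 1)) =
      sahi L (Function.update (fun j => charFn (D j)) i (Pi.single q 1)) := by
  induction hm : Fintype.card ι using Nat.strong_induction_on generalizing ι with
  | _ m ih =>
    rw [sahi_update_single, sahi_update_single, hL]
    congr 1
    refine Finset.sum_congr rfl fun a _ => ?_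
    rw [ih _ (hm ▸ Fintype.card_subtype_lt (x := i) (by simp)) (fun b : {x // x ≠ i} => D b) a
      (fun j _ => h j j.2) rfl]
    simp only [h a a.2]

/-- Nonnegativity of Sahi's functional on families of fewer than `n` lower sets. -/
def SahiNonnegBelow [LE Ω] (n : ℕ) : Prop :=
  ∀ (κ : Type) [Fintype κ] [DecidableEq κ] [Nonempty κ], Fintype.card κ < n →
    ∀ D : κ → Finset Ω, (∀ k, IsLowerSet (D k : Set Ω)) → 0 ≤ sahi L fun k => charFn (D k)

/-- Inserting a point mass outside one of the other sets contributes nonpositively. -/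
theorem sahi_update_single_nonpos [LE Ω] {n : ℕ} (hn : SahiNonnegBelow L n) {p : Ω}
    (hL : 0 ≤ L (Pi.single p 1)) {ι : Type} [Fintype ι] [DecidableEq ι]
    (hcard : Fintype.card ι ≤ n) (D : ι → Finset Ω) (hD : ∀ j, IsLowerSet (D j : Set Ω))
    {i k : ι} (hki : k ≠ i) (hk : p ∉ D k) :
    sahi L (Function.update (fun j => charFn (D j)) i (Pi.single p 1)) ≤ 0 := by
  induction hm : Fintype.card ι using Nat.strong_induction_on generalizing ι with
  | _ m ih =>
    have hlt : Fintype.card {x // x ≠ i} < m :=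
      hm ▸ Fintype.card_subtype_lt (x := i) (by simp)
    have : Nonempty {x // x ≠ i} := ⟨⟨k, hki⟩⟩
    rw [sahi_update_single]
    refine sub_nonpos_of_le ((Finset.sum_nonpos fun a _ => ?_).trans
      (mul_nonneg hL (hn _ (by omega) _ fun b => hD b)))
    split_ifs with ha
    · refine ih _ hlt (by omega) (fun b : {x // x ≠ i} => D b) (fun b => hD b) (k := ⟨k, hki⟩)
        ?_ hk rfl
      rintro rfl
      exact hk ha
    · exact le_rfl

/-- A linear functional that is nonnegative on characteristic functions of lower sets is
nonnegative on nonnegative decreasing functions. -/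
theorem LinearMap.nonneg_of_antitone_s11 [Fintype Ω] [Preorder Ω]
    (hL : ∀ D : Finset Ω, IsLowerSet (D : Set Ω) → 0 ≤ L (charFn D)) {g : Ω → ℝ}
    (hg : 0 ≤ g) (hanti : Antitone g) : 0 ≤ L g := by
  induction hm : (Finset.univ.filter fun p => g p ≠ 0).card using Nat.strong_induction_on
    generalizing g with
  | _ m ih =>
    set D := Finset.univ.filter fun p => g p ≠ 0 with hDdef
    have hmem (p : Ω) : p ∈ D ↔ g p ≠ 0 := by simp [hDdef]
    have hD : IsLowerSet (D : Set Ω) := by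
      intro p q hqp hp
      have hp' : g p ≠ 0 := (hmem p).1 hp
      exact (hmem q).2 (((hg p).lt_of_ne' hp').trans_le (hanti hqp)).ne'
    rcases D.eq_empty_or_nonempty with hempty | hne
    · have : g = 0 := by
        ext p
        by_contra h
        have := (hmem p).2 h
        simp [hempty] at this
      simp [this]
    · obtain ⟨q, hqD, hq⟩ := D.exists_min_image g hne
      have hsplit : g = (g - g q • charFn D) + g q • charFn D := by simp
      have hval (p : Ω) : (g - g q • charFn D) p = if p ∈ D then g p - g q else 0 := by
        by_cases hp : p ∈ D
        · simp [charFn, hp]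
        · have : g p = 0 := by simpa [hmem] using hp
          simp [charFn, hp, this]
      rw [hsplit, map_add, map_smul]
      refine add_nonneg (ih _ ?_ ?_ ?_ rfl) (mul_nonneg (hg q) (hL D hD))
      · rw [← hm]
        refine Finset.card_lt_card (Finset.ssubset_iff_of_subset ?_ |>.2 ⟨q, hqD, ?_⟩)
        · intro p hp
          by_contra hpD
          simp only [Finset.mem_filter, Finset.mem_univ, true_and, hval, if_neg hpD] at hp
          exact hp rfl
        · simp only [Finset.mem_filter, Finset.mem_univ, true_and, hval, if_pos hqD]
          simp
      · intro p
        rw [hval]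
        split_ifs with hp
        · exact sub_nonneg.2 (hq p hp)
        · exact le_rfl
      · intro p p' hpp'
        simp only [hval]
        split_ifs with h1 h2 h2
        · exact sub_le_sub_right (hanti hpp') _
        · exact absurd (hD hpp' h1) h2
        · exact sub_nonneg.2 (hq p h2)
        · exact le_rfl

end Indicator

section Extremal

variable {Ω κ : Type*} [DecidableEq Ω] [Fintype κ] [DecidableEq κ]

/-- A family of lower sets minimizing Sahi's functional and, among the minimizers, of largest
total cardinality. -/
structure IsSahiExtremal [LE Ω] (L : (Ω → ℝ) →ₗ[ℝ] ℝ) (D : κ → Finset Ω) : Prop where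
  isLowerSet : ∀ k, IsLowerSet (D k : Set Ω)
  sahi_le : ∀ D' : κ → Finset Ω, (∀ k, IsLowerSet (D' k : Set Ω)) →
    sahi L (fun k => charFn (D k)) ≤ sahi L fun k => charFn (D' k)
  sum_card_le : ∀ D' : κ → Finset Ω, (∀ k, IsLowerSet (D' k : Set Ω)) →
    sahi L (fun k => charFn (D' k)) ≤ sahi L (fun k => charFn (D k)) →
    ∑ k, (D' k).card ≤ ∑ k, (D k).card

theorem exists_isSahiExtremal [Fintype Ω] [LE Ω] (κ : Type*) [Fintype κ] [DecidableEq κ]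
    (L : (Ω → ℝ) →ₗ[ℝ] ℝ) :
    ∃ D : κ → Finset Ω, IsSahiExtremal L D := by
  classical
  let S : Finset (κ → Finset Ω) := Finset.univ.filter fun D => ∀ k, IsLowerSet (D k : Set Ω)
  have hS (D) : D ∈ S ↔ ∀ k, IsLowerSet (D k : Set Ω) := by simp [S]
  obtain ⟨D₀, hD₀, hmin⟩ := S.exists_min_image (fun D => sahi L fun k => charFn (D k))
    ⟨fun _ => ∅, (hS _).2 fun _ => by simpa using isLowerSet_empty⟩
  obtain ⟨D, hD, hmax⟩ := (S.filter fun D => sahi L (fun k => charFn (D k)) ≤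
    sahi L fun k => charFn (D₀ k)).exists_max_image (fun D => ∑ k, (D k).card)
    ⟨D₀, by simp [hD₀]⟩
  rw [Finset.mem_filter] at hD
  exact ⟨D, (hS D).1 hD.1, fun D' hD' => hD.2.trans (hmin D' ((hS D').2 hD')),
    fun D' hD' hle => hmax D' (Finset.mem_filter.2 ⟨(hS D').2 hD', hle.trans hD.2⟩)⟩

namespace IsSahiExtremal

variable [LE Ω] {L : (Ω → ℝ) →ₗ[ℝ] ℝ} {D : κ → Finset Ω}

theorem isLowerSet_update (hD : IsSahiExtremal L D) {i : κ} {D' : Finset Ω}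
    (hD' : IsLowerSet (D' : Set Ω)) (k : κ) :
    IsLowerSet (Function.update D i D' k : Set Ω) := by
  rcases eq_or_ne k i with rfl | h
  · simpa using hD'
  · simpa [h] using hD.isLowerSet k

theorem sum_pos (hD : IsSahiExtremal L D) {i : κ} {U : Finset Ω} (hU : U.Nonempty)
    (hdisj : Disjoint (D i) U) (hlower : IsLowerSet ((D i ∪ U : Finset Ω) : Set Ω)) :
    0 < ∑ p ∈ U, sahi L (Function.update (fun k => charFn (D k)) i (Pi.single p 1)) := by
  by_contra! hle
  have h := sahi_update_union L D i hdisj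
  rw [Function.update_eq_self] at h
  have hcard := hD.sum_card_le _ (hD.isLowerSet_update (i := i) hlower) (by linarith)
  refine hcard.not_gt (Finset.sum_lt_sum (fun k _ => ?_) ⟨i, Finset.mem_univ i, ?_⟩)
  · rcases eq_or_ne k i with rfl | hk
    · simpa using Finset.card_le_card Finset.subset_union_left
    · simp [hk]
  · rw [Function.update_self, Finset.card_union_of_disjoint hdisj]
    exact Nat.lt_add_of_pos_right hU.card_pos

theorem sum_nonpos (hD : IsSahiExtremal L D) {i : κ} {V : Finset Ω} (hV : V ⊆ D i)
    (hlower : IsLowerSet ((D i \ V : Finset Ω) : Set Ω)) :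
    ∑ p ∈ V, sahi L (Function.update (fun k => charFn (D k)) i (Pi.single p 1)) ≤ 0 := by
  have h := sahi_update_union L D i (Finset.sdiff_disjoint (s := V) (t := D i))
  rw [Finset.sdiff_union_of_subset hV, Function.update_eq_self] at h
  have := hD.sahi_le _ (hD.isLowerSet_update (i := i) hlower)
  linarith

end IsSahiExtremal

/-- In an extremal family, below any point missing from one set there is a point missing from
that set but lying in all the others. -/
theorem IsSahiExtremal.exists_le_notMem {κ : Type} [Fintype κ] [DecidableEq κ] [Fintype Ω]
    [PartialOrder Ω]
    {L : (Ω → ℝ) →ₗ[ℝ] ℝ} {D : κ → Finset Ω} (hD : IsSahiExtremal L D)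
    (hn : SahiNonnegBelow L (Fintype.card κ)) (hL : ∀ p, 0 ≤ L (Pi.single p 1))
    {j : κ} {q : Ω} (hq : q ∉ D j) :
    ∃ r ≤ q, r ∉ D j ∧ ∀ k, k ≠ j → r ∈ D k := by
  obtain ⟨r, hrq, hr⟩ := (Finset.univ.filter fun r => r ∉ D j).exists_le_minimal
    (a := q) (by simpa using hq)
  have hrD : r ∉ D j := by simpa using hr.prop
  refine ⟨r, hrq, hrD, fun k hk => ?_⟩
  by_contra hrk
  have hpos := hD.sum_pos (i := j) (U := {r}) (Finset.singleton_nonempty r) (by simpa using hrD) ?_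
  · rw [Finset.sum_singleton] at hpos
    exact hpos.not_ge
      (sahi_update_single_nonpos L hn (hL r) le_rfl D hD.isLowerSet hk hrk)
  · intro a b hba ha
    simp only [Finset.coe_union, Finset.coe_singleton, Set.union_singleton, Set.mem_insert_iff,
      Finset.mem_coe] at ha ⊢
    rcases ha with rfl | ha
    · by_contra! hb
      exact hb.1 (le_antisymm hba (hr.le_of_le (by simpa using hb.2) hba))
    · exact Or.inr (hD.isLowerSet j hba ha)

end Extremal

section Product

variable {X Y : Type*} [Fintype X] [LinearOrder X] [Fintype Y] [LinearOrder Y]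
  {L : (X × Y → ℝ) →ₗ[ℝ] ℝ}

/-- In an extremal family on a product of two chains, at most one set is proper. -/
theorem IsSahiExtremal.exists_forall_ne_eq_univ {κ : Type} [Fintype κ] [DecidableEq κ] [Nonempty κ]
    {D : κ → Finset (X × Y)} (hD : IsSahiExtremal L D)
    (hn : SahiNonnegBelow L (Fintype.card κ)) (hL : ∀ p, 0 ≤ L (Pi.single p 1))
    (hLeq : ∀ p q, L (Pi.single p 1) = L (Pi.single q 1)) :
    ∃ i, ∀ j, j ≠ i → D j = Finset.univ := by
  by_cases hall : ∀ j, D j = Finset.univ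
  · exact ⟨Classical.arbitrary κ, fun j _ => hall j⟩
  obtain ⟨p, ⟨i, hpi⟩, hpmin⟩ : ∃ p : X × Y, (∃ i, p ∉ D i) ∧
      ∀ j q, q ∉ D j → toLex p ≤ toLex q := by
    simp only [not_forall, Finset.eq_univ_iff_forall] at hall
    obtain ⟨j, q, hq⟩ := hall
    obtain ⟨p, hp, hmin⟩ := (Finset.univ.filter fun p => ∃ i, p ∉ D i).exists_min_image toLex
      ⟨q, by simpa using ⟨j, hq⟩⟩
    exact ⟨p, by simpa using hp, fun j q hq => hmin q (by simpa using ⟨j, hq⟩)⟩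
  obtain ⟨x, y⟩ := p
  have hfst (q : X × Y) (j : κ) (hq : q ∉ D j) : x ≤ q.1 := by
    rcases (Prod.Lex.le_iff.1 (hpmin j q hq)) with h | h
    · exact h.le
    · exact h.1.le
  have hnot (q : X × Y) (hx : x ≤ q.1) (hy : y ≤ q.2) : q ∉ D i := fun hq =>
    hpi (hD.isLowerSet i (show (x, y) ≤ q from ⟨hx, hy⟩) hq)
  have hbelow (j : κ) (hj : j ≠ i) (q : X × Y) (hq : q ∉ D j) :
      ∃ r ≤ q, r ∉ D j ∧ r.2 < y := by
    obtain ⟨r, hrq, hrj, hr⟩ := hD.exists_le_notMem hn hL hq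
    exact ⟨r, hrq, hrj, lt_of_not_ge fun hy => hnot r (hfst r j hrj) hy (hr i hj.symm)⟩
  refine ⟨i, fun j hj => Finset.eq_univ_iff_forall.2 fun q => ?_⟩
  by_contra hq
  obtain ⟨r, -, -, hry⟩ := hbelow j hj q hq
  obtain ⟨z, hz⟩ := exists_covBy_of_wellFoundedGT (not_isMin_of_lt hry)
  let R := Finset.univ.filter fun x' => x ≤ x' ∧ (x', z) ∈ D i
  have hR (x' : X) : x' ∈ R ↔ x ≤ x' ∧ (x', z) ∈ D i := by simp [R]
  have hxR : x ∈ R := by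
    refine (hR x).2 ⟨le_rfl, ?_⟩
    by_contra h
    rcases (Prod.Lex.le_iff.1 (hpmin i _ h)) with h' | h'
    · exact lt_irrefl _ h'
    · exact h'.2.not_gt hz.lt
  have hnonpos := hD.sum_nonpos (i := i) (V := R.image fun x' => (x', z)) ?_ ?_
  · have hpos := hD.sum_pos (i := i) (U := R.image fun x' => (x', y))
      ⟨_, Finset.mem_image_of_mem _ hxR⟩ ?_ ?_
    · rw [Finset.sum_image (fun a _ b _ h => (Prod.ext_iff.1 h).1)] at hpos hnonpos
      refine hpos.not_ge (le_trans (Finset.sum_le_sum fun x' _ => ?_) hnonpos)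
      refine (sahi_update_single_congr L (hLeq _ _) D i fun k hk => ⟨fun h => ?_, fun h => ?_⟩).le
      · exact hD.isLowerSet k (show (x', z) ≤ (x', y) from ⟨le_rfl, hz.le⟩) h
      · by_contra hk'
        obtain ⟨r, hrle, hrk, hry⟩ := hbelow k hk _ hk'
        exact hrk (hD.isLowerSet k (show r ≤ (x', z) from ⟨hrle.1, hz.le_of_lt hry⟩) h)
    · rw [Finset.disjoint_right]
      rintro q hq
      obtain ⟨x', hx', rfl⟩ := Finset.mem_image.1 hq
      exact hnot _ ((hR x').1 hx').1 le_rfl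
    · intro a b hba ha
      rw [Finset.mem_coe, Finset.mem_union] at ha ⊢
      rcases ha with ha | ha
      · exact Or.inl (hD.isLowerSet i hba ha)
      obtain ⟨x', hx', rfl⟩ := Finset.mem_image.1 ha
      obtain ⟨-, hx'z⟩ := (hR x').1 hx'
      rcases hba.2.lt_or_eq with hb | hb
      · exact Or.inl (hD.isLowerSet i (show b ≤ (x', z) from ⟨hba.1, hz.le_of_lt hb⟩) hx'z)
      · by_cases hbi : b ∈ D i
        · exact Or.inl hbi
        · refine Or.inr (Finset.mem_image.2 ⟨b.1, (hR _).2 ⟨hfst b i hbi, ?_⟩,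
            Prod.ext rfl hb.symm⟩)
          exact hD.isLowerSet i (show (b.1, z) ≤ (x', z) from ⟨hba.1, le_rfl⟩) hx'z
  · intro q hq
    obtain ⟨x', hx', rfl⟩ := Finset.mem_image.1 hq
    exact ((hR x').1 hx').2
  · intro a b hba ha
    rw [Finset.mem_coe, Finset.mem_sdiff] at ha ⊢
    refine ⟨hD.isLowerSet i hba ha.1, fun hb => ha.2 ?_⟩
    obtain ⟨x', hx', rfl⟩ := Finset.mem_image.1 hb
    have hxa : x ≤ a.1 := ((hR x').1 hx').1.trans hba.1
    have haz : a.2 = z := by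
      refine le_antisymm (hz.le_of_lt (lt_of_not_ge fun h => hnot a hxa h ha.1)) hba.2
    subst haz
    exact Finset.mem_image.2 ⟨a.1, (hR _).2 ⟨hxa, ha.1⟩, rfl⟩

theorem sahiNonnegBelow_prod (hL : ∀ p, 0 ≤ L (Pi.single p 1))
    (hLeq : ∀ p q, L (Pi.single p 1) = L (Pi.single q 1)) (hLone : L 1 ≤ 1) (n : ℕ) :
    SahiNonnegBelow L n := by
  induction n with
  | zero => exact fun κ _ _ _ h => absurd h (Nat.not_lt_zero _)
  | succ n ih =>
    intro κ _ _ _ hcard D hD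
    have hn : SahiNonnegBelow L (Fintype.card κ) := fun κ' _ _ _ h => ih κ' (by omega)
    obtain ⟨D₀, hD₀⟩ := exists_isSahiExtremal κ L
    refine le_trans ?_ (hD₀.sahi_le D hD)
    obtain ⟨i, hi⟩ := hD₀.exists_forall_ne_eq_univ hn hL hLeq
    by_cases hj : ∃ j, j ≠ i
    · obtain ⟨j, hj⟩ := hj
      have : Nonempty {x // x ≠ j} := ⟨⟨i, hj.symm⟩⟩
      rw [sahi_of_eq_one L (i := j) (by rw [hi j hj, charFn_univ])]
      have hone : (1 : ℝ) ≤ Fintype.card {x // x ≠ j} := by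
        exact_mod_cast Fintype.card_pos
      exact mul_nonneg (by linarith) (hn {x // x ≠ j}
        (Fintype.card_subtype_lt (x := j) (by simp)) _ fun b => hD₀.isLowerSet b)
    · push Not at hj
      let _ : Unique κ := ⟨⟨i⟩, hj⟩
      rw [sahi_of_unique, charFn_eq_sum, map_sum]
      exact Finset.sum_nonneg fun p _ => hL p

/-- Sahi's inequality for nonnegative decreasing functions on a product of two finite chains with
a uniform measure of total mass at most one. -/
theorem sahi_nonneg_of_antitone (hL : ∀ p, 0 ≤ L (Pi.single p 1))
    (hLeq : ∀ p q, L (Pi.single p 1) = L (Pi.single q 1)) (hLone : L 1 ≤ 1)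
    {ι : Type} [Fintype ι] [DecidableEq ι] [Nonempty ι] {f : ι → X × Y → ℝ}
    (hf : ∀ i, 0 ≤ f i) (hanti : ∀ i, Antitone (f i)) : 0 ≤ sahi L f := by
  suffices h : ∀ (s : Finset ι) (f : ι → X × Y → ℝ), (∀ i, 0 ≤ f i) → (∀ i, Antitone (f i)) →
      (∀ i, i ∉ s → ∃ D : Finset (X × Y), IsLowerSet (D : Set (X × Y)) ∧ f i = charFn D) →
      0 ≤ sahi L f from h Finset.univ f hf hanti (by simp)
  intro s
  induction s using Finset.induction_on with
  | empty =>
    intro f _ _ h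
    choose D hD hfD using fun i => h i (Finset.notMem_empty i)
    rw [show f = fun i => charFn (D i) from funext hfD]
    exact sahiNonnegBelow_prod hL hLeq hLone _ ι (Nat.lt_succ_self _) D hD
  | insert i s _ ih =>
    intro f hf hanti h
    obtain ⟨Λ, hΛ⟩ := exists_linearMap_sahi_update L f i
    rw [← Function.update_eq_self i f, hΛ]
    refine LinearMap.nonneg_of_antitone_s11 Λ (fun D hD => ?_) (hf i) (hanti i)
    have hcharFn : 0 ≤ charFn D := fun p => by
      unfold charFn
      split_ifs <;> simp
    have hcharFn' : Antitone (charFn D) := fun p q hpq => by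
      unfold charFn
      split_ifs with hq hp
      · exact le_rfl
      · exact absurd (hD hpq hq) hp
      · exact zero_le_one
      · exact le_rfl
    rw [← hΛ]
    refine ih _ (fun k => ?_) (fun k => ?_) fun k hk => ?_ <;> rcases eq_or_ne k i with rfl | hki
    · simpa using hcharFn
    · simpa [hki] using hf k
    · simpa using hcharFn'
    · simpa [hki] using hanti k
    · exact ⟨D, hD, by simp⟩
    · simpa [hki] using h k (by simp [hki, hk])

end Product

section Riemann

/-- The uniform expectation on the `N × N` grid. -/
noncomputable def gridMean (N : ℕ) : (Fin N × Fin N → ℝ) →ₗ[ℝ] ℝ :=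
  ((N : ℝ)⁻¹ * (N : ℝ)⁻¹) • ∑ p, LinearMap.proj p

theorem gridMean_apply (N : ℕ) (g : Fin N × Fin N → ℝ) :
    gridMean N g = (N : ℝ)⁻¹ * (N : ℝ)⁻¹ * ∑ p, g p := by
  simp [gridMean]

/-- The point of the plane with coordinates `a / N` and `b / N`. -/
noncomputable def gridPoint (N a b : ℕ) : Fin 2 → ℝ := ![a / N, b / N]

theorem gridPoint_mono (N : ℕ) {a b a' b' : ℕ} (ha : a ≤ a') (hb : b ≤ b') :
    gridPoint N a b ≤ gridPoint N a' b' := by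
  intro i
  fin_cases i <;> simp only [gridPoint] <;> simp <;> gcongr

theorem gridPoint_mem_Icc {N a b : ℕ} (ha : a ≤ N) (hb : b ≤ N) :
    gridPoint N a b ∈ Set.Icc (0 : Fin 2 → ℝ) 1 := by
  refine ⟨fun i => ?_, fun i => ?_⟩
  · fin_cases i <;> simp [gridPoint] <;> positivity
  · fin_cases i <;> simp only [gridPoint] <;> simp <;>
      exact div_le_one_of_le₀ (by exact_mod_cast ‹_›) (by positivity)

/-- The half-open cell of the `N × N` grid with lower left corner `gridPoint N p.1 p.2`. -/
def gridCell (N : ℕ) (p : Fin N × Fin N) : Set (Fin 2 → ℝ) :=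
  Set.univ.pi fun i => Set.Ico (gridPoint N p.1 p.2 i) (gridPoint N (p.1 + 1) (p.2 + 1) i)

theorem measurableSet_gridCell (N : ℕ) (p : Fin N × Fin N) : MeasurableSet (gridCell N p) :=
  MeasurableSet.univ_pi fun _ => measurableSet_Ico

theorem volume_real_gridCell (N : ℕ) (p : Fin N × Fin N) :
    (volume : Measure (Fin 2 → ℝ)).real (gridCell N p) = (N : ℝ)⁻¹ * (N : ℝ)⁻¹ := by
  rw [Measure.real, gridCell, Real.volume_pi_Ico_toReal
    (gridPoint_mono N (Nat.le_succ _) (Nat.le_succ _))]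
  simp [gridPoint, Fin.prod_univ_two]
  ring

theorem mem_gridCell_iff {N : ℕ} (hN : 0 < N) (p : Fin N × Fin N) {x : Fin 2 → ℝ} (hx : 0 ≤ x) :
    x ∈ gridCell N p ↔ ⌊x 0 * N⌋₊ = p.1 ∧ ⌊x 1 * N⌋₊ = p.2 := by
  have hN' : (0 : ℝ) < N := by exact_mod_cast hN
  rw [Nat.floor_eq_iff (mul_nonneg (hx 0) hN'.le), Nat.floor_eq_iff (mul_nonneg (hx 1) hN'.le)]
  simp [gridCell, gridPoint, div_le_iff₀ hN', lt_div_iff₀ hN']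

theorem gridCell_subset_Icc (N : ℕ) (p : Fin N × Fin N) :
    gridCell N p ⊆ Set.Icc (gridPoint N p.1 p.2) (gridPoint N (p.1 + 1) (p.2 + 1)) :=
  fun _ hx => ⟨fun i => (hx i trivial).1, fun i => (hx i trivial).2.le⟩

theorem gridCell_subset_unitSquare (N : ℕ) (p : Fin N × Fin N) :
    gridCell N p ⊆ Set.Icc (0 : Fin 2 → ℝ) 1 :=
  (gridCell_subset_Icc N p).trans (Set.Icc_subset_Icc
    (gridPoint_mem_Icc p.1.2.le p.2.2.le).1 (gridPoint_mem_Icc p.1.2 p.2.2).2)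

theorem iUnion_gridCell {N : ℕ} (hN : 0 < N) :
    ⋃ p, gridCell N p = Set.univ.pi fun i => Set.Ico ((0 : Fin 2 → ℝ) i) ((1 : Fin 2 → ℝ) i) := by
  have hN' : (0 : ℝ) < N := by exact_mod_cast hN
  ext x
  rw [Set.mem_iUnion]
  constructor
  · rintro ⟨p, hp⟩ i -
    refine ⟨(gridPoint_mem_Icc p.1.2.le p.2.2.le).1 i |>.trans (hp i trivial).1,
      (hp i trivial).2.trans_le ((gridPoint_mem_Icc p.1.2 p.2.2).2 i)⟩
  · intro hx
    have hx0 : 0 ≤ x := fun i => (hx i trivial).1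
    have hlt (i : Fin 2) : ⌊x i * N⌋₊ < N := by
      rw [Nat.floor_lt (mul_nonneg (hx0 i) hN'.le)]
      have : x i < 1 := (hx i trivial).2
      nlinarith
    exact ⟨(⟨_, hlt 0⟩, ⟨_, hlt 1⟩), (mem_gridCell_iff hN _ hx0).2 ⟨rfl, rfl⟩⟩

theorem pairwise_disjoint_gridCell {N : ℕ} (hN : 0 < N) :
    Pairwise (Function.onFun Disjoint (gridCell N)) := by
  intro p q hpq
  rw [Function.onFun, Set.disjoint_left]
  intro x hp hq
  have hx : 0 ≤ x := (gridCell_subset_unitSquare N p hp).1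
  rw [mem_gridCell_iff hN _ hx] at hp hq
  exact hpq (Prod.ext (Fin.ext (hp.1.symm.trans hq.1)) (Fin.ext (hp.2.symm.trans hq.2)))

theorem sum_sub_sum_succ_le {N : ℕ} {G : ℕ → ℕ → ℝ} {M : ℝ}
    (h0 : ∀ a ≤ N, ∀ b ≤ N, 0 ≤ G a b) (hM : ∀ a ≤ N, ∀ b ≤ N, G a b ≤ M) :
    ∑ a ∈ Finset.range N, ∑ b ∈ Finset.range N, G a b -
      ∑ a ∈ Finset.range N, ∑ b ∈ Finset.range N, G (a + 1) (b + 1) ≤ 2 * N * M := by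
  have hcols : ∑ b ∈ Finset.range N, G 0 b - ∑ b ∈ Finset.range N, G N b ≤ N * M := by
    have h1 : ∑ b ∈ Finset.range N, G 0 b ≤ N * M := by
      simpa using Finset.sum_le_card_nsmul (Finset.range N) (fun b => G 0 b) M
        fun b hb => hM 0 (Nat.zero_le _) b (Finset.mem_range.1 hb).le
    have h2 : 0 ≤ ∑ b ∈ Finset.range N, G N b :=
      Finset.sum_nonneg fun b hb => h0 N le_rfl b (Finset.mem_range.1 hb).le
    linarith
  have hrows : ∑ a ∈ Finset.range N, (G (a + 1) 0 - G (a + 1) N) ≤ N * M := by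
    simpa using Finset.sum_le_card_nsmul (Finset.range N) (fun a => G (a + 1) 0 - G (a + 1) N) M
      fun a ha => by
        have ha' : a + 1 ≤ N := Finset.mem_range.1 ha
        linarith [hM _ ha' 0 (Nat.zero_le _), h0 _ ha' N le_rfl]
  have htel : ∑ a ∈ Finset.range N, ∑ b ∈ Finset.range N, G a b -
      ∑ a ∈ Finset.range N, ∑ b ∈ Finset.range N, G (a + 1) b =
        ∑ b ∈ Finset.range N, G 0 b - ∑ b ∈ Finset.range N, G N b := by
    rw [← Finset.sum_sub_distrib, Finset.sum_range_sub' fun a => ∑ b ∈ Finset.range N, G a b]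
  have htel' : ∑ a ∈ Finset.range N, ∑ b ∈ Finset.range N, G (a + 1) b -
      ∑ a ∈ Finset.range N, ∑ b ∈ Finset.range N, G (a + 1) (b + 1) =
        ∑ a ∈ Finset.range N, (G (a + 1) 0 - G (a + 1) N) := by
    rw [← Finset.sum_sub_distrib]
    refine Finset.sum_congr rfl fun a _ => ?_
    rw [← Finset.sum_sub_distrib, Finset.sum_range_sub' (G (a + 1))]
  linarith

variable {g : (Fin 2 → ℝ) → ℝ}

theorem integrableOn_of_antitoneOn_Icc (hg : Measurable g)
    (hpos : ∀ x ∈ Set.Icc (0 : Fin 2 → ℝ) 1, 0 ≤ g x) (hanti : AntitoneOn g (Set.Icc 0 1)) :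
    IntegrableOn g (Set.Icc (0 : Fin 2 → ℝ) 1) := by
  refine Measure.integrableOn_of_bounded (M := g 0) ?_ hg.aestronglyMeasurable ?_
  · exact isCompact_Icc.measure_lt_top.ne
  · refine (ae_restrict_iff' measurableSet_Icc).2 (Filter.Eventually.of_forall fun x hx => ?_)
    rw [Real.norm_of_nonneg (hpos x hx)]
    exact hanti ⟨le_rfl, zero_le_one⟩ hx hx.1

theorem integral_eq_sum_gridCell (hg : IntegrableOn g (Set.Icc (0 : Fin 2 → ℝ) 1)) {N : ℕ}
    (hN : 0 < N) :
    ∫ x in Set.Icc (0 : Fin 2 → ℝ) 1, g x = ∑ p, ∫ x in gridCell N p, g x := by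
  rw [← integral_iUnion_fintype (measurableSet_gridCell N) (pairwise_disjoint_gridCell hN),
    iUnion_gridCell hN]
  · exact (setIntegral_congr_set Measure.univ_pi_Ico_ae_eq_Icc).symm
  · exact fun p => hg.mono_set (gridCell_subset_unitSquare N p)

/-- Riemann sums of nonnegative decreasing functions on the unit square converge. -/
theorem tendsto_gridMean (hg : Measurable g)
    (hpos : ∀ x ∈ Set.Icc (0 : Fin 2 → ℝ) 1, 0 ≤ g x) (hanti : AntitoneOn g (Set.Icc 0 1)) :
    Filter.Tendsto (fun N => gridMean N fun p => g (gridPoint N p.1 p.2)) Filter.atTop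
      (nhds (∫ x in Set.Icc (0 : Fin 2 → ℝ) 1, g x)) := by
  have hint := integrableOn_of_antitoneOn_Icc hg hpos hanti
  have hcell := gridCell_subset_unitSquare
  have hfin (N : ℕ) (p : Fin N × Fin N) : volume (gridCell N p) ≠ ⊤ :=
    ((measure_mono (hcell N p)).trans_lt isCompact_Icc.measure_lt_top).ne
  have hlower (N : ℕ) (hN : 0 < N) :
      ∫ x in Set.Icc (0 : Fin 2 → ℝ) 1, g x ≤ gridMean N fun p => g (gridPoint N p.1 p.2) := by
    rw [integral_eq_sum_gridCell hint hN, gridMean_apply, Finset.mul_sum]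
    refine Finset.sum_le_sum fun p _ => ?_
    rw [← volume_real_gridCell N p, ← smul_eq_mul, ← setIntegral_const]
    refine setIntegral_mono_on (hint.mono_set (hcell N p)) (integrableOn_const (hfin N p))
      (measurableSet_gridCell N p) fun x hx => ?_
    exact hanti (gridPoint_mem_Icc p.1.2.le p.2.2.le) (hcell N p hx) (gridCell_subset_Icc N p hx).1
  have hupper (N : ℕ) (hN : 0 < N) : (gridMean N fun p => g (gridPoint N p.1 p.2)) ≤
      (∫ x in Set.Icc (0 : Fin 2 → ℝ) 1, g x) + 2 * g 0 * (N : ℝ)⁻¹ := by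
    have hN' : (0 : ℝ) < N := by exact_mod_cast hN
    have hshift : (gridMean N fun p => g (gridPoint N (p.1 + 1) (p.2 + 1))) ≤
        ∫ x in Set.Icc (0 : Fin 2 → ℝ) 1, g x := by
      rw [integral_eq_sum_gridCell hint hN, gridMean_apply, Finset.mul_sum]
      refine Finset.sum_le_sum fun p _ => ?_
      rw [← volume_real_gridCell N p, ← smul_eq_mul, ← setIntegral_const]
      refine setIntegral_mono_on (integrableOn_const (hfin N p)) (hint.mono_set (hcell N p))
        (measurableSet_gridCell N p) fun x hx => ?_
      exact hanti (hcell N p hx) (gridPoint_mem_Icc p.1.2 p.2.2) (gridCell_subset_Icc N p hx).2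
    have hdiff := sum_sub_sum_succ_le (N := N) (G := fun a b => g (gridPoint N a b)) (M := g 0)
      (fun a ha b hb => hpos _ (gridPoint_mem_Icc ha hb))
      (fun a ha b hb => hanti ⟨le_rfl, zero_le_one⟩ (gridPoint_mem_Icc ha hb)
        (gridPoint_mem_Icc ha hb).1)
    simp only [Finset.sum_range] at hdiff
    rw [gridMean_apply, Fintype.sum_prod_type] at hshift ⊢
    have hmul := mul_le_mul_of_nonneg_left hdiff (by positivity : 0 ≤ (N : ℝ)⁻¹ * (N : ℝ)⁻¹)
    rw [show (N : ℝ)⁻¹ * (N : ℝ)⁻¹ * (2 * N * g 0) = 2 * g 0 * (N : ℝ)⁻¹ by field_simp,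
      mul_sub] at hmul
    dsimp only at hshift ⊢
    linarith
  refine tendsto_of_tendsto_of_tendsto_of_le_of_le' tendsto_const_nhds
    (h := fun N : ℕ => (∫ x in Set.Icc (0 : Fin 2 → ℝ) 1, g x) + 2 * g 0 * (N : ℝ)⁻¹) ?_
    ((Filter.eventually_gt_atTop 0).mono hlower) ((Filter.eventually_gt_atTop 0).mono hupper)
  simpa using (tendsto_inv_atTop_nhds_zero_nat (𝕜 := ℝ)).const_mul (2 * g 0) |>.const_add
    (∫ x in Set.Icc (0 : Fin 2 → ℝ) 1, g x)

end Riemann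

theorem En_eq_neg_sum {Ω ι : Type*} [MeasurableSpace Ω] (μ : Measure Ω) [Fintype ι]
    [DecidableEq ι] [Nonempty ι] (f : ι → Ω → ℝ) :
    En μ f = -∑ σ : Equiv.Perm ι, ∏ O ∈ permOrbits σ, -∫ ω, (∏ i ∈ O, f i ω) ∂μ := by
  rw [En, ← Finset.sum_neg_distrib]
  refine Finset.sum_congr rfl fun σ _ => ?_
  obtain ⟨c, hc⟩ := Nat.exists_eq_succ_of_ne_zero (permOrbits_nonempty σ).card_pos.ne'
  rw [permE, Finset.prod_neg, hc]
  simp [pow_succ]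

/-- Let `n ≥ 1` and let `f¹,…,fⁿ` be nonnegative, monotone decreasing,
Lebesgue-measurable functions on the unit square `[0,1]²`.  Then, with respect to Lebesgue
(probability) measure on `[0,1]²`, `E_n(f¹,…,fⁿ) ≥ 0`. -/
theorem stmt_11 (n : ℕ) (hn : 1 ≤ n)
    (f : Fin n → (Fin 2 → ℝ) → ℝ)
    (hmeas : ∀ i, Measurable (f i))
    (hpos : ∀ i, ∀ x ∈ Set.Icc (0 : Fin 2 → ℝ) 1, 0 ≤ f i x)
    (hmono : ∀ i, ∀ x ∈ Set.Icc (0 : Fin 2 → ℝ) 1, ∀ y ∈ Set.Icc (0 : Fin 2 → ℝ) 1,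
      x ≤ y → f i y ≤ f i x) :
    0 ≤ En (volume.restrict (Set.Icc (0 : Fin 2 → ℝ) 1)) f := by
  have : Nonempty (Fin n) := ⟨⟨0, hn⟩⟩
  have hprod (O : Finset (Fin n)) : Filter.Tendsto
      (fun N => gridMean N (∏ i ∈ O, fun p => f i (gridPoint N p.1 p.2))) Filter.atTop
      (nhds (∫ x in Set.Icc (0 : Fin 2 → ℝ) 1, ∏ i ∈ O, f i x)) := by
    convert tendsto_gridMean (g := fun x => ∏ i ∈ O, f i x)
      (Finset.measurable_prod O fun i _ => hmeas i)
      (fun x hx => Finset.prod_nonneg fun i _ => hpos i x hx)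
      (fun x hx y hy hxy => Finset.prod_le_prod (fun i _ => hpos i y hy)
        fun i _ => hmono i x hx y hy hxy) using 3 with N
    ext p
    simp
  have htendsto : Filter.Tendsto
      (fun N => sahi (gridMean N) fun i p => f i (gridPoint N p.1 p.2)) Filter.atTop
      (nhds (En (volume.restrict (Set.Icc (0 : Fin 2 → ℝ) 1)) f)) := by
    rw [En_eq_neg_sum]
    exact (tendsto_finsetSum _ fun σ _ => tendsto_finsetProd _ fun O _ => (hprod O).neg).neg
  refine ge_of_tendsto htendsto ((Filter.eventually_gt_atTop 0).mono fun N hN => ?_)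
  have hN' : (N : ℝ) ≠ 0 := by exact_mod_cast hN.ne'
  refine sahi_nonneg_of_antitone (fun p => ?_) (fun p q => ?_) ?_ (fun i p => ?_)
    fun i p q hpq => ?_
  · simp [gridMean_apply]
    positivity
  · simp [gridMean_apply]
  · simp [gridMean_apply]
    field_simp
    rfl
  · exact hpos i _ (gridPoint_mem_Icc p.1.2.le p.2.2.le)
  · exact hmono i _ (gridPoint_mem_Icc p.1.2.le p.2.2.le) _ (gridPoint_mem_Icc q.1.2.le q.2.2.le)
      (gridPoint_mono N hpq.1 hpq.2)
end
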